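/- For every integer ν ≥ 2 there exists a constant C(ν) > 0 such that for every prime p, all integers a, b with gcd(a, p) = 1, and every interval I = [K+1, K+M] ⊆ [1, p-1] of M integers, one has |∑_{m∈I} ∑_{x=0}^{p-1} e_p(m(a x² + b x))| ≤ C(ν) M^{1 - 1/ν} p^{(2ν - 1)/(4(ν - 1))} (log p)². -/

import Mathlib

/-- `e_p(z) = exp(2πiz/p)`. -/
noncomputable def ep (p : ℕ) (z : ℤ) : ℂ := Complex.exp (2 * Real.pi * Complex.I * z / p)

open Polynomial in
/-- The derivation `f · d/dX` on polynomials. -/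
noncomputable def scaledDerivative {K : Type*} [Field K] (f : K[X]) : K[X] →ₗ[K] K[X] :=
  LinearMap.mulLeft K f ∘ₗ derivative

open Polynomial in
/-- The operator sending `s` to the `A s` with `f * derivative (s * f ^ c) = A s * f ^ c`. -/
noncomputable def twistedDerivative {K : Type*} [Field K] (f : K[X]) (c : ℕ) : K[X] →ₗ[K] K[X] :=
  LinearMap.mulLeft K f ∘ₗ derivative + LinearMap.mulLeft K ((c : K[X]) * derivative f)

section Stepanov
open Polynomial

lemma scaledDerivative_apply {K : Type*} [Field K] (f r : K[X]) :
    scaledDerivative f r = f * derivative r := rfl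

lemma twistedDerivative_apply {K : Type*} [Field K] (f r : K[X]) (c : ℕ) :
    twistedDerivative f c r = f * derivative r + (c : K[X]) * derivative f * r := rfl

lemma scaledDerivative_mul_pow {K : Type*} [Field K] (f s : K[X]) (c : ℕ) :
    scaledDerivative f (s * f ^ c) = twistedDerivative f c s * f ^ c := by
  rw [scaledDerivative_apply, twistedDerivative_apply, derivative_mul, derivative_pow]
  rcases c with _ | c
  · simp
  · simp only [Nat.add_sub_cancel, map_natCast]
    ring

lemma scaledDerivative_mul_X_pow {p : ℕ} [Fact p.Prime] (f r : (ZMod p)[X]) (j : ℕ) :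
    scaledDerivative f (r * X ^ (p * j)) = scaledDerivative f r * X ^ (p * j) := by
  rw [scaledDerivative_apply, scaledDerivative_apply, derivative_mul, derivative_X_pow]
  have : ((p * j : ℕ) : ZMod p) = 0 := by simp
  rw [this]
  simp [mul_assoc]

lemma iterate_scaledDerivative_sum {p : ℕ} [Fact p.Prime] (f : (ZMod p)[X]) {J : ℕ} (c k : ℕ)
    (r s : Fin J → (ZMod p)[X]) :
    (scaledDerivative f ^ k) (∑ j, (r j + s j * f ^ c) * X ^ (p * (j : ℕ))) =
      ∑ j, ((scaledDerivative f ^ k) (r j) + (twistedDerivative f c ^ k) (s j) * f ^ c) *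
        X ^ (p * (j : ℕ)) := by
  induction k with
  | zero => simp
  | succ k ih =>
    simp only [pow_succ', Module.End.mul_apply]
    rw [ih, map_sum]
    refine Finset.sum_congr rfl fun j _ => ?_
    rw [scaledDerivative_mul_X_pow, map_add, scaledDerivative_mul_pow]

lemma degree_scaledDerivative_lt {K : Type*} [Field K] (f r : K[X]) (n : ℕ) (h : r.degree < n) :
    (scaledDerivative f r).degree < ((n + f.natDegree : ℕ) : WithBot ℕ) := by
  rw [scaledDerivative_apply]
  by_cases hr : f * derivative r = 0
  · rw [hr, degree_zero]; exact WithBot.bot_lt_coe _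
  rw [degree_mul]
  have hf : f ≠ 0 := left_ne_zero_of_mul hr
  have hd : (derivative r).degree < n := (degree_derivative_le).trans_lt h
  have hd0 : derivative r ≠ 0 := right_ne_zero_of_mul hr
  rw [degree_eq_natDegree hf, degree_eq_natDegree hd0] at *
  norm_cast at *
  omega

lemma degree_twistedDerivative_lt {K : Type*} [Field K] (f r : K[X]) (c n : ℕ) (h : r.degree < n) :
    (twistedDerivative f c r).degree < ((n + f.natDegree : ℕ) : WithBot ℕ) := by
  rw [twistedDerivative_apply]
  refine (degree_add_le _ _).trans_lt (max_lt (degree_scaledDerivative_lt f r n h) ?_)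
  by_cases hr : (c : K[X]) * derivative f * r = 0
  · rw [hr, degree_zero]; exact WithBot.bot_lt_coe _
  have hr0 : r ≠ 0 := right_ne_zero_of_mul hr
  have h1 : ((c : K[X]) * derivative f * r).natDegree ≤ f.natDegree + r.natDegree := by
    refine natDegree_mul_le.trans (Nat.add_le_add_right ?_ _)
    refine natDegree_mul_le.trans ?_
    rw [natDegree_natCast, zero_add]
    exact (natDegree_derivative_le f).trans (Nat.sub_le _ _)
  rw [degree_eq_natDegree hr0] at h
  rw [degree_eq_natDegree hr]
  norm_cast at *
  omega

lemma degree_pow_apply_lt {K : Type*} [Field K] (A : K[X] →ₗ[K] K[X]) (m : ℕ)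
    (hA : ∀ (r : K[X]) (n : ℕ), r.degree < n → (A r).degree < ((n + m : ℕ) : WithBot ℕ))
    (r : K[X]) (n k : ℕ) (h : r.degree < n) :
    ((A ^ k) r).degree < ((n + k * m : ℕ) : WithBot ℕ) := by
  induction k with
  | zero => simpa using h
  | succ k ih =>
    rw [pow_succ', Module.End.mul_apply]
    have := hA _ _ ih
    rwa [add_assoc, ← Nat.succ_mul] at this

lemma pow_dvd_of_eval_iterate_scaledDerivative {p : ℕ} [Fact p.Prime] (f : (ZMod p)[X])
    (x : ZMod p) (hx : f.eval x ≠ 0) (l : ℕ) (hl : l ≤ p) :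
    ∀ P : (ZMod p)[X], (∀ k < l, ((scaledDerivative f ^ k) P).eval x = 0) →
      (X - C x) ^ l ∣ P := by
  induction l with
  | zero => intro P _; simp
  | succ l ih =>
    intro P hP
    by_cases hP0 : P = 0
    · simp [hP0]
    have h1 : (X - C x) ^ l ∣ scaledDerivative f P := by
      refine ih (by omega) _ fun k hk => ?_
      have := hP (k + 1) (by omega)
      rwa [pow_succ, Module.End.mul_apply] at this
    rw [scaledDerivative_apply] at h1
    have hcop : IsCoprime ((X - C x) ^ l) f := by
      refine IsCoprime.pow_left ?_
      rw [(irreducible_X_sub_C x).coprime_iff_not_dvd, dvd_iff_isRoot]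
      exact hx
    have h2 : (X - C x) ^ l ∣ derivative P := hcop.dvd_of_dvd_mul_left h1
    have h0 : P.IsRoot x := by simpa using hP 0 (by omega)
    obtain ⟨Q, hQ, hQx⟩ := exists_eq_pow_rootMultiplicity_mul_and_not_dvd P hP0 x
    set n := P.rootMultiplicity x with hn
    have hn1 : 1 ≤ n := (rootMultiplicity_pos hP0).2 h0
    by_contra hcon
    have hnl : n ≤ l := by
      by_contra h
      exact hcon ((pow_dvd_pow _ (by omega)).trans (hQ ▸ dvd_mul_right _ _))
    apply hQx
    obtain ⟨d, hd⟩ : ∃ d, n = d + 1 := ⟨n - 1, by omega⟩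
    have h3 : (X - C x) ^ (d + 1) ∣ derivative P := (pow_dvd_pow _ (by omega)).trans h2
    rw [hQ, hd, derivative_mul, derivative_X_sub_C_pow] at h3
    have h4 : (X - C x) ^ (d + 1) ∣ C ((d + 1 : ℕ) : ZMod p) * (X - C x) ^ d * Q := by
      refine (dvd_add_left (dvd_mul_right _ _)).1 h3
    have h5 : (X - C x) ∣ C ((d + 1 : ℕ) : ZMod p) * Q := by
      have : C ((d + 1 : ℕ) : ZMod p) * (X - C x) ^ d * Q =
        (X - C x) ^ d * (C ((d + 1 : ℕ) : ZMod p) * Q) := by ring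
      rw [this, pow_succ] at h4
      exact (mul_dvd_mul_iff_left (pow_ne_zero _ (X_sub_C_ne_zero x))).1 h4
    have hne : ((d + 1 : ℕ) : ZMod p) ≠ 0 := by
      rw [Ne, ZMod.natCast_eq_zero_iff]
      intro h
      have := Nat.le_of_dvd (by omega) h
      omega
    have hu : IsUnit (C ((d + 1 : ℕ) : ZMod p)) := isUnit_C.2 (isUnit_iff_ne_zero.2 hne)
    exact (hu.dvd_mul_left).1 h5

lemma eq_zero_of_X_pow_dvd {p : ℕ} [Fact p.Prime] (hp : p ≠ 2) (f r s : (ZMod p)[X])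
    (hodd : Odd f.natDegree) (hf0 : f.coeff 0 ≠ 0) (D : ℕ) (hD1 : 1 ≤ D)
    (hD : 2 * D + f.natDegree ≤ p + 1) (hr : r.degree < D) (hs : s.degree < D)
    (h : X ^ p ∣ r + s * f ^ (p / 2)) :
    r = 0 ∧ s = 0 := by
  have hpodd : 2 * (p / 2) + 1 = p := by
    have := (Fact.out : p.Prime).eq_two_or_odd
    omega
  have hf : f ≠ 0 := by rintro rfl; simp at hf0
  have h1 : X ^ p ∣ f * r ^ 2 - s ^ 2 * f ^ p := by
    have : f * r ^ 2 - s ^ 2 * f ^ p =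
        (r + s * f ^ (p / 2)) * (f * (r - s * f ^ (p / 2))) := by
      have hfp : f ^ p = (f ^ (p / 2)) ^ 2 * f := by
        rw [← pow_mul, ← pow_succ]
        congr 1
        omega
      rw [hfp]
      ring
    rw [this]
    exact h.mul_right _
  have h2 : X ^ p ∣ f ^ p - C (f.coeff 0) := by
    have : X ∣ f - C (f.coeff 0) := by
      rw [X_dvd_iff]; simp
    have := map_dvd (expand (ZMod p) p) this
    rwa [expand_X, map_sub, expand_C, ZMod.expand_card] at this
  have h3 : X ^ p ∣ f * r ^ 2 - s ^ 2 * C (f.coeff 0) := by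
    have : f * r ^ 2 - s ^ 2 * C (f.coeff 0) =
        (f * r ^ 2 - s ^ 2 * f ^ p) + s ^ 2 * (f ^ p - C (f.coeff 0)) := by ring
    rw [this]
    exact dvd_add h1 (h2.mul_left _)
  have hd : ∀ t : (ZMod p)[X], t.degree < D → t ≠ 0 → t.natDegree < D := by
    intro t ht h0
    rw [degree_eq_natDegree h0] at ht
    exact_mod_cast ht
  have hlt : ∀ t : (ZMod p)[X], t.degree < D → 2 * t.natDegree + f.natDegree < p := by
    intro t ht
    by_cases h0 : t = 0
    · have := hodd.pos
      subst h0
      simp only [natDegree_zero]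
      omega
    · have := hd t ht h0
      omega
  have h4 : f * r ^ 2 - s ^ 2 * C (f.coeff 0) = 0 := by
    refine eq_zero_of_dvd_of_natDegree_lt h3 ?_
    rw [natDegree_X_pow]
    refine (natDegree_sub_le _ _).trans_lt (max_lt ?_ ?_)
    · refine natDegree_mul_le.trans_lt ?_
      have := hlt r hr
      have h6 := natDegree_pow_le (p := r) (n := 2)
      omega
    · refine natDegree_mul_le.trans_lt ?_
      have := hlt s hs
      have h6 := natDegree_pow_le (p := s) (n := 2)
      rw [natDegree_C]
      omega
  have h5 : f * r ^ 2 = s ^ 2 * C (f.coeff 0) := sub_eq_zero.1 h4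
  have hr0 : r = 0 := by
    by_contra hr0
    have h6 := congrArg natDegree h5
    rw [natDegree_mul hf (pow_ne_zero _ hr0), natDegree_mul_C hf0, natDegree_pow,
      natDegree_pow] at h6
    obtain ⟨q, hq⟩ := hodd
    omega
  refine ⟨hr0, ?_⟩
  rw [hr0] at h5
  have : s ^ 2 * C (f.coeff 0) = 0 := by rw [← h5]; ring
  rcases mul_eq_zero.1 this with h | h
  · exact pow_eq_zero_iff (two_ne_zero) |>.1 h
  · exact absurd (C_eq_zero.1 h) hf0

lemma auxiliary_sum_ne_zero {p : ℕ} [Fact p.Prime] (hp : p ≠ 2) (f : (ZMod p)[X])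
    (hodd : Odd f.natDegree) (hf0 : f.coeff 0 ≠ 0) (D J : ℕ) (hD1 : 1 ≤ D)
    (hD : 2 * D + f.natDegree ≤ p + 1)
    (r s : Fin J → (ZMod p)[X]) (hr : ∀ j, (r j).degree < D) (hs : ∀ j, (s j).degree < D)
    (h : ∑ j, (r j + s j * f ^ (p / 2)) * X ^ (p * (j : ℕ)) = 0) (j : Fin J) :
    r j = 0 ∧ s j = 0 := by
  obtain ⟨n, hn⟩ := j
  induction n using Nat.strong_induction_on with
  | _ n ih =>
    refine eq_zero_of_X_pow_dvd hp f _ _ hodd hf0 D hD1 hD (hr _) (hs _) ?_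
    have h1 : X ^ (p * n) * X ^ p ∣ X ^ (p * n) * (r ⟨n, hn⟩ + s ⟨n, hn⟩ * f ^ (p / 2)) := by
      rw [← Finset.add_sum_erase _ _ (Finset.mem_univ (⟨n, hn⟩ : Fin J))] at h
      rw [mul_comm _ (r _ + _), eq_neg_of_add_eq_zero_left h, dvd_neg]
      refine Finset.dvd_sum fun i hi => ?_
      obtain ⟨i, hiJ⟩ := i
      rcases lt_trichotomy i n with hin | hin | hin
      · rw [(ih i hin hiJ).1, (ih i hin hiJ).2]
        simp
      · simp [hin] at hi
      · rw [← pow_add, ← Nat.mul_succ]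
        exact (pow_dvd_pow _ (Nat.mul_le_mul_left p hin)).mul_left _
    exact (mul_dvd_mul_iff_left (pow_ne_zero _ X_ne_zero)).1 h1

/-- The linear conditions imposed on the auxiliary polynomial have a nonzero solution. -/
lemma exists_auxiliary_family {p : ℕ} [Fact p.Prime] (f : (ZMod p)[X]) (c D J l : ℕ)
    (hcount : l * (D + l * f.natDegree + J) < 2 * J * D) :
    ∃ r s : Fin J → (ZMod p)[X], (∀ j, (r j).degree < D) ∧ (∀ j, (s j).degree < D) ∧
      ¬ (∀ j, r j = 0 ∧ s j = 0) ∧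
      ∀ k < l, ∑ j, ((scaledDerivative f ^ k) (r j) + (twistedDerivative f c ^ k) (s j)) *
        X ^ (j : ℕ) = 0 := by
  set E := D + l * f.natDegree + J with hE
  let ι : (Fin D → ZMod p) →ₗ[ZMod p] (ZMod p)[X] :=
    (degreeLT (ZMod p) D).subtype ∘ₗ (degreeLTEquiv (ZMod p) D).symm.toLinearMap
  have hι : ∀ v, (ι v).degree < D := fun v =>
    mem_degreeLT.1 ((degreeLTEquiv (ZMod p) D).symm v).2
  have hι0 : ∀ v, ι v = 0 → v = 0 := by
    intro v hv
    have h1 : (degreeLTEquiv (ZMod p) D).symm v = 0 := Subtype.ext hv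
    simpa using h1
  let Q : ℕ → ((Fin J → Fin D → ZMod p) × (Fin J → Fin D → ZMod p)) →ₗ[ZMod p] (ZMod p)[X] :=
    fun k => ∑ j : Fin J, LinearMap.mulRight (ZMod p) (X ^ (j : ℕ)) ∘ₗ
      ((scaledDerivative f ^ k) ∘ₗ ι ∘ₗ LinearMap.proj j ∘ₗ LinearMap.fst _ _ _ +
       (twistedDerivative f c ^ k) ∘ₗ ι ∘ₗ LinearMap.proj j ∘ₗ LinearMap.snd _ _ _)
  have hQ : ∀ k v, Q k v = ∑ j, ((scaledDerivative f ^ k) (ι (v.1 j)) +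
      (twistedDerivative f c ^ k) (ι (v.2 j))) * X ^ (j : ℕ) := by
    intro k v
    simp [Q, LinearMap.sum_apply]
  let L : ((Fin J → Fin D → ZMod p) × (Fin J → Fin D → ZMod p)) →ₗ[ZMod p]
      (Fin l → Fin E → ZMod p) :=
    LinearMap.pi fun k => LinearMap.pi fun e => lcoeff (ZMod p) (e : ℕ) ∘ₗ Q k
  have hker : LinearMap.ker L ≠ ⊥ := by
    apply LinearMap.ker_ne_bot_of_finrank_lt
    simp only [Module.finrank_prod, Module.finrank_pi_fintype, Module.finrank_self,
      Finset.sum_const, Finset.card_univ, Fintype.card_fin, smul_eq_mul, mul_one]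
    calc l * E < 2 * J * D := hcount
      _ = _ := by ring
  obtain ⟨v, hv, hv0⟩ := Submodule.exists_mem_ne_zero_of_ne_bot hker
  refine ⟨fun j => ι (v.1 j), fun j => ι (v.2 j), fun j => hι _, fun j => hι _, ?_, ?_⟩
  · intro h
    apply hv0
    refine Prod.ext (funext fun j => hι0 _ (h j).1) (funext fun j => hι0 _ (h j).2)
  · intro k hk
    rw [← hQ]
    ext e
    rw [coeff_zero]
    by_cases he : e < E
    · have := congrFun (congrFun hv ⟨k, hk⟩) ⟨e, he⟩
      simpa [L] using this
    · apply coeff_eq_zero_of_degree_lt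
      refine lt_of_lt_of_le ?_ (Nat.cast_le.2 (not_lt.1 he) : (E : WithBot ℕ) ≤ _)
      rw [hQ]
      refine (degree_sum_le _ _).trans_lt ?_
      rw [Finset.sup_lt_iff (WithBot.bot_lt_coe _)]
      intro j _
      have h1 : ((scaledDerivative f ^ k) (ι (v.1 j)) +
          (twistedDerivative f c ^ k) (ι (v.2 j))).degree <
          ((D + l * f.natDegree : ℕ) : WithBot ℕ) := by
        have hkl : ((D + k * f.natDegree : ℕ) : WithBot ℕ) ≤ ((D + l * f.natDegree : ℕ)) :=
          Nat.cast_le.2 (Nat.add_le_add_left (Nat.mul_le_mul_right _ hk.le) _)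
        refine (degree_add_le _ _).trans_lt (max_lt ?_ ?_)
        · exact (degree_pow_apply_lt _ _ (degree_scaledDerivative_lt f) _ _ k (hι _)).trans_le hkl
        · exact (degree_pow_apply_lt _ _ (fun r n => degree_twistedDerivative_lt f r c n) _ _ k
            (hι _)).trans_le hkl
      rw [degree_mul, degree_X_pow]
      by_cases h0 : (scaledDerivative f ^ k) (ι (v.1 j)) +
          (twistedDerivative f c ^ k) (ι (v.2 j)) = 0
      · rw [h0, degree_zero, WithBot.bot_add]
        exact WithBot.bot_lt_coe _
      · rw [degree_eq_natDegree h0] at h1 ⊢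
        have := j.2
        norm_cast at *
        omega

/-- Stepanov's bound for the number of points where `f` is a nonzero square. -/
lemma stepanov_count {p : ℕ} [Fact p.Prime] (hp : p ≠ 2) (f : (ZMod p)[X])
    (hodd : Odd f.natDegree) (hf0 : f.coeff 0 ≠ 0) (D J l : ℕ) (hD1 : 1 ≤ D)
    (hD : 2 * D + f.natDegree ≤ p + 1) (hl : l ≤ p)
    (hcount : l * (D + l * f.natDegree + J) < 2 * J * D) :
    (Finset.univ.filter fun x : ZMod p => f.eval x ^ (p / 2) = 1).card * l ≤
      p * (J + f.natDegree) := by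
  obtain ⟨r, s, hr, hs, hne, hQ⟩ := exists_auxiliary_family f (p / 2) D J l hcount
  set P : (ZMod p)[X] := ∑ j, (r j + s j * f ^ (p / 2)) * X ^ (p * (j : ℕ)) with hPdef
  have hP0 : P ≠ 0 := fun h => hne fun j =>
    auxiliary_sum_ne_zero hp f hodd hf0 D J hD1 hD r s hr hs h j
  set S := Finset.univ.filter fun x : ZMod p => f.eval x ^ (p / 2) = 1 with hS
  have hp2 : p / 2 ≠ 0 := by
    have := (Fact.out : p.Prime).two_le
    omega
  have hdvd : ∏ x ∈ S, (X - C x) ^ l ∣ P := by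
    refine Finset.prod_dvd_of_coprime ?_ ?_
    · intro x _ y _ hxy
      exact (pairwise_coprime_X_sub_C Function.injective_id hxy).pow
    · intro x hx
      have hx1 : f.eval x ^ (p / 2) = 1 := (Finset.mem_filter.1 hx).2
      refine pow_dvd_of_eval_iterate_scaledDerivative f x ?_ l hl P fun k hk => ?_
      · intro h
        rw [h, zero_pow hp2] at hx1
        exact zero_ne_one hx1
      · rw [hPdef, iterate_scaledDerivative_sum, ← eval_zero (x := x), ← hQ k hk, eval_finsetSum,
          eval_finsetSum]
        refine Finset.sum_congr rfl fun j _ => ?_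
        simp only [eval_mul, eval_add, eval_pow, eval_X, hx1, mul_one, pow_mul, ZMod.pow_card]
  have h1 := natDegree_le_of_dvd hdvd hP0
  rw [natDegree_prod _ _ fun x _ => pow_ne_zero _ (X_sub_C_ne_zero x)] at h1
  simp only [natDegree_pow, natDegree_X_sub_C, mul_one, Finset.sum_const, smul_eq_mul] at h1
  refine h1.trans ?_
  refine natDegree_sum_le_of_forall_le _ _ fun j _ => ?_
  refine natDegree_mul_le.trans ?_
  rw [natDegree_X_pow]
  have hd : ∀ t : (ZMod p)[X], t.degree < D → t.natDegree ≤ D := by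
    intro t ht
    exact natDegree_le_of_degree_le ht.le
  have h2 : (r j + s j * f ^ (p / 2)).natDegree ≤ D + p * f.natDegree := by
    refine (natDegree_add_le _ _).trans (max_le ((hd _ (hr j)).trans (Nat.le_add_right _ _)) ?_)
    refine natDegree_mul_le.trans (Nat.add_le_add (hd _ (hs j)) ?_)
    refine natDegree_pow_le.trans (Nat.mul_le_mul_right _ (Nat.div_le_self _ _))
  have h3 : p * (j + 1) ≤ p * J := Nat.mul_le_mul_left p j.2
  have hodd' := hodd.pos
  calc _ ≤ (D + p * f.natDegree) + p * j := Nat.add_le_add_right h2 _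
    _ ≤ p * (J + f.natDegree) := by nlinarith

end Stepanov

section CharacterSum
open Polynomial

lemma card_eval_pow_eq_one_le {p : ℕ} [Fact p.Prime] (hp : p ≠ 2) (f : (ZMod p)[X])
    (hodd : Odd f.natDegree) (hf0 : f.coeff 0 ≠ 0) :
    ((Finset.univ.filter fun x : ZMod p => f.eval x ^ (p / 2) = 1).card : ℝ) ≤
      p / 2 + 16 * f.natDegree * √p := by
  set m := f.natDegree with hm
  set N := (Finset.univ.filter fun x : ZMod p => f.eval x ^ (p / 2) = 1).card with hN
  have hm1 : 1 ≤ m := hodd.pos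
  have hpp : (0 : ℝ) ≤ p := Nat.cast_nonneg p
  have hsq : √(p : ℝ) * √p = p := Real.mul_self_sqrt hpp
  have hs0 : 0 ≤ √(p : ℝ) := Real.sqrt_nonneg _
  by_cases hsmall : p < 16 * m
  · have h1 : (N : ℝ) ≤ p := by
      have : N ≤ Fintype.card (ZMod p) := Finset.card_le_univ _
      rw [ZMod.card] at this
      exact_mod_cast this
    have h2 : (p : ℝ) ≤ 16 * m := by exact_mod_cast hsmall.le
    have h3 : √(p : ℝ) ≤ 16 * m := by
      rw [Real.sqrt_le_left (by positivity)]
      have h4 : (1 : ℝ) ≤ m := by exact_mod_cast hm1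
      nlinarith
    nlinarith
  push Not at hsmall
  set k := Nat.sqrt p / 2 with hk
  have hk1 : 2 * k ≤ Nat.sqrt p := by omega
  have hk2 : Nat.sqrt p ≤ 2 * k + 1 := by omega
  have hk3 : (2 * k) * (2 * k) ≤ p := (Nat.mul_self_le_mul_self hk1).trans (Nat.sqrt_le p)
  have hk4 : 4 ≤ Nat.sqrt p := by
    rw [Nat.le_sqrt]; omega
  have hk5 : p < (2 * k + 2) * (2 * k + 2) :=
    Nat.sqrt_lt.1 (by omega)
  have hpodd := (Fact.out : p.Prime).eq_two_or_odd
  obtain ⟨q, hq⟩ := hodd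
  obtain ⟨D, hD⟩ : ∃ D, 2 * D + m = p := ⟨(p - m) / 2, by omega⟩
  have h8 : 8 * k ≤ p := by nlinarith [show 2 ≤ k by omega]
  have hcount : 2 * k * (D + 2 * k * m + (k + (2 * m + 2))) < 2 * (k + (2 * m + 2)) * D := by
    have h5 : m * ((2 * k) * (2 * k)) ≤ m * p := Nat.mul_le_mul_left m hk3
    have h6 : (2 * m + 2) * (m + 2 * k) * 16 ≤ (2 * m + 2) * (5 * p) := by
      rw [mul_assoc]
      exact Nat.mul_le_mul_left _ (by omega)
    have h7 : (2 * m + 2) * (2 * D) = (2 * m + 2) * p - (2 * m + 2) * m := by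
      rw [← Nat.mul_sub]
      congr 1
      omega
    have h9 : (2 * m + 2) * m ≤ (2 * m + 2) * p := Nat.mul_le_mul_left _ (by omega)
    zify [h9] at *
    nlinarith
  have hmain := stepanov_count hp f ⟨q, hq⟩ hf0 D (k + (2 * m + 2)) (2 * k) (by omega)
    (by omega) (by omega) hcount
  rw [← hN, ← hm] at hmain
  have hmain' : (N : ℝ) * (2 * k) ≤ p * (k + (2 * m + 2) + m) := by exact_mod_cast hmain
  have hk5' : √(p : ℝ) ≤ 2 * k + 2 := by
    rw [Real.sqrt_le_left (by positivity)]
    have : (p : ℝ) ≤ (2 * k + 2) * (2 * k + 2) := by exact_mod_cast hk5.le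
    nlinarith
  have hk6 : (2 : ℝ) ≤ k := by exact_mod_cast (show 2 ≤ k by omega)
  have hm1' : (1 : ℝ) ≤ m := by exact_mod_cast hm1
  have hk7 : √(p : ℝ) ≤ 4 * k := by linarith
  have h10 : (p : ℝ) * (3 * m + 2) ≤ 16 * m * √p * (2 * k) := by
    calc (p : ℝ) * (3 * m + 2) ≤ p * (5 * m) := by gcongr; linarith
      _ = √p * (√p * (5 * m)) := by rw [← mul_assoc (√(p : ℝ)), hsq]
      _ ≤ √p * (4 * k * (5 * m)) := by gcongr
      _ ≤ 16 * m * √p * (2 * k) := by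
        nlinarith [mul_nonneg hs0 (mul_nonneg (by linarith : (0 : ℝ) ≤ k)
          (by linarith : (0 : ℝ) ≤ m))]
  have h2k : (0 : ℝ) < 2 * k := by linarith
  refine le_of_mul_le_mul_right ?_ h2k
  nlinarith

lemma card_quadraticChar_eval_eq_one_le {p : ℕ} [Fact p.Prime] (hp : p ≠ 2) (f : (ZMod p)[X])
    (hodd : Odd f.natDegree) (hf0 : f.coeff 0 ≠ 0) :
    ((Finset.univ.filter fun x : ZMod p => quadraticChar (ZMod p) (f.eval x) = 1).card : ℝ) ≤
      p / 2 + 16 * f.natDegree * √p := by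
  refine le_trans ?_ (card_eval_pow_eq_one_le hp f hodd hf0)
  refine Nat.cast_le.2 (Finset.card_le_card fun x hx => ?_)
  simp only [Finset.mem_filter, Finset.mem_univ, true_and] at hx ⊢
  have := quadraticChar_eq_pow_of_char_ne_two' (F := ZMod p)
    (by rwa [ZMod.ringChar_zmod_n]) (f.eval x)
  rw [hx, ZMod.card] at this
  simpa using this.symm

lemma abs_sum_quadraticChar_eval_le {p : ℕ} [Fact p.Prime] (hp : p ≠ 2) (f : (ZMod p)[X])
    (hodd : Odd f.natDegree) (hf0 : f.coeff 0 ≠ 0) :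
    |((∑ x : ZMod p, quadraticChar (ZMod p) (f.eval x) : ℤ) : ℝ)| ≤ 33 * f.natDegree * √p := by
  set χ := quadraticChar (ZMod p) with hχ
  have hring : ringChar (ZMod p) ≠ 2 := by rwa [ZMod.ringChar_zmod_n]
  obtain ⟨g, hg⟩ := quadraticChar_exists_neg_one hring
  have hg0 : g ≠ 0 := by rintro rfl; simp at hg
  have hf : f ≠ 0 := by rintro rfl; simp at hf0
  have h1 := card_quadraticChar_eval_eq_one_le hp f hodd hf0
  have h2 := card_quadraticChar_eval_eq_one_le hp (C g * f)
    (by rwa [natDegree_C_mul hg0]) (by simpa using ⟨hg0, hf0⟩)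
  rw [natDegree_C_mul hg0] at h2
  simp only [eval_mul, eval_C, map_mul, hg] at h2
  have hval : ∀ v : ZMod p, χ v = (if χ v = 1 then 1 else 0) - (if -1 * χ v = 1 then 1 else 0) := by
    intro v
    by_cases hv : v = 0
    · simp [hv, hχ]
    · rcases quadraticChar_dichotomy hv with h | h <;> simp [hχ, h]
  have hone : ∀ v : ZMod p, (1 : ℤ) = (if χ v = 1 then 1 else 0) +
      (if -1 * χ v = 1 then 1 else 0) + (if v = 0 then 1 else 0) := by
    intro v
    by_cases hv : v = 0
    · simp [hv, hχ]
    · rcases quadraticChar_dichotomy hv with h | h <;> simp [hχ, h, hv]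
  have hz : (Finset.univ.filter fun x : ZMod p => f.eval x = 0).card ≤ f.natDegree := by
    refine (Finset.card_le_card ?_).trans (f.roots.toFinset_card_le.trans (card_roots' f))
    intro x hx
    simpa [hf] using hx
  have hs := Finset.sum_congr rfl fun (x : ZMod p) (_ : x ∈ Finset.univ) => hval (f.eval x)
  have ho := Finset.sum_congr rfl fun (x : ZMod p) (_ : x ∈ Finset.univ) => hone (f.eval x)
  simp only [Finset.sum_sub_distrib, Finset.sum_add_distrib, Finset.sum_boole, Finset.sum_const,
    Finset.card_univ, ZMod.card, mul_one, nsmul_eq_mul] at hs ho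
  rw [hs]
  have ho' := congrArg (Int.cast : ℤ → ℝ) ho
  push_cast at ho' ⊢
  have hz' : ((Finset.univ.filter fun x : ZMod p => f.eval x = 0).card : ℝ) ≤ f.natDegree := by
    exact_mod_cast hz
  have hz0 : (0 : ℝ) ≤ ((Finset.univ.filter fun x : ZMod p => f.eval x = 0).card : ℝ) :=
    Nat.cast_nonneg _
  have hsp : (1 : ℝ) ≤ √p := by
    rw [Real.one_le_sqrt]
    exact_mod_cast (Fact.out : p.Prime).one_le
  have hm0 : (0 : ℝ) ≤ f.natDegree := Nat.cast_nonneg _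
  have : (f.natDegree : ℝ) ≤ f.natDegree * √p := le_mul_of_one_le_right hm0 hsp
  rw [abs_le]
  constructor <;> linarith

lemma abs_sum_quadraticChar_prod_finset_le {p : ℕ} [Fact p.Prime] (hp : p ≠ 2)
    (T : Finset (ZMod p)) (hT : T.Nonempty) (heven : Even T.card) :
    |((∑ x : ZMod p, quadraticChar (ZMod p) (∏ r ∈ T, (x + r)) : ℤ) : ℝ)| ≤
      34 * T.card * √p := by
  obtain ⟨r₀, hr₀⟩ := hT
  set χ := quadraticChar (ZMod p) with hχ
  set f : (ZMod p)[X] := ∏ r ∈ T.erase r₀, (C (r - r₀) * X + C 1) with hf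
  have hne : ∀ r ∈ T.erase r₀, r - r₀ ≠ 0 := fun r hr => sub_ne_zero.2 (Finset.ne_of_mem_erase hr)
  have hcard : (T.erase r₀).card + 1 = T.card := Finset.card_erase_add_one hr₀
  have hdeg : f.natDegree = (T.erase r₀).card := by
    rw [hf, natDegree_prod]
    · rw [Finset.sum_congr rfl fun r hr => natDegree_linear (hne r hr)]
      simp
    · intro r hr h
      have := natDegree_linear (b := 1) (hne r hr)
      rw [h] at this
      simp at this
  have heval : ∀ y, f.eval y = ∏ r ∈ T.erase r₀, ((r - r₀) * y + 1) := by
    intro y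
    rw [hf, eval_prod]
    simp
  have hf0 : f.eval 0 = 1 := by rw [heval]; simp
  have hodd : Odd f.natDegree := by
    rw [hdeg]
    obtain ⟨c, hc⟩ := heven
    exact ⟨c - 1, by omega⟩
  have hW := abs_sum_quadraticChar_eval_le hp f hodd (by rw [coeff_zero_eq_eval_zero, hf0]; simp)
  have hsub : ∑ x : ZMod p, χ (∏ r ∈ T, (x + r)) =
      ∑ y : ZMod p, χ (∏ r ∈ T, (y⁻¹ - r₀ + r)) := by
    refine (Fintype.sum_equiv ((Equiv.inv (ZMod p)).trans (Equiv.subRight r₀)) _ _ ?_).symm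
    intro y
    simp
  have hterm : ∀ y : ZMod p, χ (∏ r ∈ T, (y⁻¹ - r₀ + r)) =
      χ (f.eval y) - if y = 0 then 1 else 0 := by
    intro y
    by_cases hy : y = 0
    · have : ∏ r ∈ T, (y⁻¹ - r₀ + r) = 0 := Finset.prod_eq_zero hr₀ (by simp [hy])
      rw [this]
      simp [hy, hf0, hχ]
    · have h1 : f.eval y = y ^ T.card * ∏ r ∈ T, (y⁻¹ - r₀ + r) := by
        have h2 : ∀ r ∈ T.erase r₀, (r - r₀) * y + 1 = y * (y⁻¹ - r₀ + r) := by
          intro r _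
          rw [mul_add, mul_sub, mul_inv_cancel₀ hy]
          ring
        rw [← Finset.mul_prod_erase T _ hr₀, ← hcard, pow_succ, heval, Finset.prod_congr rfl h2,
          Finset.prod_mul_distrib, Finset.prod_const, sub_add_cancel, mul_assoc,
          mul_inv_cancel_left₀ hy]
      rw [h1, map_mul, map_pow]
      obtain ⟨c, hc⟩ := heven
      rw [hc, ← two_mul, pow_mul, hχ, quadraticChar_sq_one hy]
      simp [hy]
  rw [hsub, Finset.sum_congr rfl fun y _ => hterm y, Finset.sum_sub_distrib]
  simp only [Finset.sum_ite_eq', Finset.mem_univ, if_true]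
  have hsp : (1 : ℝ) ≤ √p := by
    rw [Real.one_le_sqrt]
    exact_mod_cast (Fact.out : p.Prime).one_le
  have hc' : (f.natDegree : ℝ) + 1 = T.card := by rw [hdeg]; exact_mod_cast hcard
  have hm0 : (0 : ℝ) ≤ f.natDegree := Nat.cast_nonneg _
  push_cast at hW ⊢
  refine (abs_sub _ _).trans ?_
  rw [abs_one]
  nlinarith

/-- Square-root cancellation in a product of shifts, unless the product is a perfect square. -/
lemma abs_sum_prod_quadraticChar_le {p : ℕ} [Fact p.Prime] (hp : p ≠ 2) {ι : Type*} [Fintype ι]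
    {n : ℕ} (hcardι : Fintype.card ι = n) (hn : Even n) (h : ι → ZMod p)
    (hodd : ∃ r, Odd (Finset.univ.filter fun i => h i = r).card) :
    |((∑ x : ZMod p, ∏ i, quadraticChar (ZMod p) (x + h i) : ℤ) : ℝ)| ≤ 35 * n * √p := by
  set χ := quadraticChar (ZMod p) with hχ
  set c : ZMod p → ℕ := fun r => (Finset.univ.filter fun i => h i = r).card with hc
  set T := (Finset.univ.image h).filter fun r => Odd (c r) with hT
  have himage : ∀ r, c r ≠ 0 → r ∈ Finset.univ.image h := by
    intro r hr
    obtain ⟨i, hi⟩ := Finset.card_ne_zero.1 hr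
    exact Finset.mem_image.2 ⟨i, Finset.mem_univ _, (Finset.mem_filter.1 hi).2⟩
  have hTne : T.Nonempty := by
    obtain ⟨r, hr⟩ := hodd
    exact ⟨r, Finset.mem_filter.2 ⟨himage r hr.pos.ne', hr⟩⟩
  have hsum : ∑ r ∈ Finset.univ.image h, c r = n := by
    have := Finset.card_eq_sum_card_image h Finset.univ
    rw [Finset.card_univ, hcardι] at this
    exact this.symm
  have heven : Even T.card := by
    rw [← Nat.not_odd_iff_even, ← Finset.odd_sum_iff_odd_card_odd, hsum, Nat.not_odd_iff_even]
    exact hn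
  have hcardim : (Finset.univ.image h).card ≤ n := by
    rw [← hcardι]
    exact Finset.card_image_le
  have hTn : T.card ≤ n := (Finset.card_filter_le _ _).trans hcardim
  have hW := abs_sum_quadraticChar_prod_finset_le hp T hTne heven
  have hprod : ∀ x : ZMod p, ∏ i, χ (x + h i) = ∏ r ∈ Finset.univ.image h, χ (x + r) ^ c r := by
    intro x
    exact Finset.prod_comp (fun r => χ (x + r)) h
  have habs : ∀ v : ZMod p, |χ v| ≤ 1 := by
    intro v
    by_cases hv : v = 0
    · simp [hv, hχ]
    · rcases quadraticChar_dichotomy hv with h | h <;> simp [hχ, h]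
  have hterm : ∀ x : ZMod p, |∏ i, χ (x + h i) - χ (∏ r ∈ T, (x + r))| ≤
      if -x ∈ Finset.univ.image h then 1 else 0 := by
    intro x
    by_cases hx : -x ∈ Finset.univ.image h
    · have h0 : ∏ i, χ (x + h i) = 0 := by
        obtain ⟨i, _, hi⟩ := Finset.mem_image.1 hx
        refine Finset.prod_eq_zero (Finset.mem_univ i) ?_
        simp [hi, hχ]
      rw [h0, if_pos hx, zero_sub, abs_neg]
      exact habs _
    · rw [if_neg hx, hprod, map_prod, hT, Finset.prod_filter]
      refine le_of_eq ?_
      rw [abs_eq_zero, sub_eq_zero]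
      refine Finset.prod_congr rfl fun r hr => ?_
      have hxr : x + r ≠ 0 := by
        intro h0
        rw [eq_neg_of_add_eq_zero_right h0] at hr
        exact hx hr
      have hsq : χ (x + r) ^ 2 = 1 := quadraticChar_sq_one hxr
      rcases Nat.even_or_odd (c r) with hr' | hr'
      · obtain ⟨k, hk⟩ := hr'
        rw [if_neg (Nat.not_odd_iff_even.2 ⟨k, hk⟩), hk, ← two_mul, pow_mul, hsq, one_pow]
      · obtain ⟨k, hk⟩ := hr'
        rw [if_pos ⟨k, hk⟩, hk, pow_succ, pow_mul, hsq, one_pow, one_mul]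
  have hdiff : |∑ x : ZMod p, ∏ i, χ (x + h i) - ∑ x : ZMod p, χ (∏ r ∈ T, (x + r))| ≤ n := by
    rw [← Finset.sum_sub_distrib]
    refine (Finset.abs_sum_le_sum_abs _ _).trans ((Finset.sum_le_sum fun x _ => hterm x).trans ?_)
    rw [Finset.sum_boole]
    refine Nat.cast_le.2 (le_trans ?_ hcardim)
    exact Finset.card_le_card_of_injOn (fun x => -x) (fun x hx => by simpa using hx)
      (neg_injective.injOn)
  have hdiff' : |((∑ x : ZMod p, ∏ i, χ (x + h i) : ℤ) : ℝ) -
      ((∑ x : ZMod p, χ (∏ r ∈ T, (x + r)) : ℤ) : ℝ)| ≤ n := by exact_mod_cast hdiff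
  have hsp : (1 : ℝ) ≤ √p := by
    rw [Real.one_le_sqrt]
    exact_mod_cast (Fact.out : p.Prime).one_le
  have hTn' : (T.card : ℝ) ≤ n := by exact_mod_cast hTn
  have h1 : 34 * (T.card : ℝ) * √p ≤ 34 * n * √p := by gcongr
  have h2 : (n : ℝ) ≤ n * √p := le_mul_of_one_le_right (Nat.cast_nonneg _) hsp
  have h3 := abs_sub_abs_le_abs_sub ((∑ x : ZMod p, ∏ i, χ (x + h i) : ℤ) : ℝ)
    ((∑ x : ZMod p, χ (∏ r ∈ T, (x + r)) : ℤ) : ℝ)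
  linarith

end CharacterSum

/-- The coefficient of `z ^ k` in `(∑ b < B, χ (x + b) z ^ b) ^ ν`, `χ` the quadratic character. -/
noncomputable def shiftCoeff (p : ℕ) [Fact p.Prime] (B ν k : ℕ) (x : ZMod p) : ℤ :=
  ∑ b : Fin ν → Fin B with ∑ i, (b i : ℕ) = k,
    ∏ i, quadraticChar (ZMod p) (x + ((b i : ℕ) : ZMod p))

/-- The sum of squares of the coefficients of `(∑ b < B, χ (x + b) z ^ b) ^ ν`. -/
noncomputable def momentWeight (p : ℕ) [Fact p.Prime] (B ν : ℕ) (x : ZMod p) : ℤ :=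
  ∑ k ∈ Finset.range (ν * B), shiftCoeff p B ν k x ^ 2

section Moment

lemma sum_lt_mul {B ν : ℕ} (hν : 1 ≤ ν) (b : Fin ν → Fin B) : ∑ i, (b i : ℕ) < ν * B := by
  have : NeZero ν := ⟨by omega⟩
  calc ∑ i, (b i : ℕ) < ∑ _i : Fin ν, B :=
        Finset.sum_lt_sum_of_nonempty Finset.univ_nonempty fun i _ => (b i).2
    _ = ν * B := by simp

lemma norm_sum_shift_pow_le {p : ℕ} [Fact p.Prime] {B ν : ℕ} (hν : 1 ≤ ν) (x : ZMod p) (z : ℂ)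
    (hz : ‖z‖ = 1) :
    ‖∑ b : Fin B, (quadraticChar (ZMod p) (x + ((b : ℕ) : ZMod p)) : ℂ) * z ^ (b : ℕ)‖ ^ (2 * ν) ≤
      ν * B * momentWeight p B ν x := by
  have h1 : (∑ b : Fin B, (quadraticChar (ZMod p) (x + ((b : ℕ) : ZMod p)) : ℂ) *
      z ^ (b : ℕ)) ^ ν = ∑ k ∈ Finset.range (ν * B), (shiftCoeff p B ν k x : ℂ) * z ^ k := by
    rw [← Fin.prod_const, Finset.prod_univ_sum, Fintype.piFinset_univ,
      ← Finset.sum_fiberwise_of_maps_to (s := Finset.univ) (t := Finset.range (ν * B))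
        (g := fun b : Fin ν → Fin B => ∑ i, (b i : ℕ))
        (fun b _ => Finset.mem_range.2 (sum_lt_mul hν b))]
    refine Finset.sum_congr rfl fun k _ => ?_
    rw [shiftCoeff, Int.cast_sum, Finset.sum_mul]
    refine Finset.sum_congr rfl fun b hb => ?_
    rw [Finset.prod_mul_distrib, Finset.prod_pow_eq_pow_sum, (Finset.mem_filter.1 hb).2,
      Int.cast_prod]
  rw [mul_comm 2 ν, pow_mul, ← norm_pow, h1]
  have h2 : ‖∑ k ∈ Finset.range (ν * B), (shiftCoeff p B ν k x : ℂ) * z ^ k‖ ≤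
      ∑ k ∈ Finset.range (ν * B), |(shiftCoeff p B ν k x : ℝ)| := by
    refine (norm_sum_le _ _).trans_eq (Finset.sum_congr rfl fun k _ => ?_)
    rw [norm_mul, norm_pow, hz, one_pow, mul_one, Complex.norm_intCast]
  refine (pow_le_pow_left₀ (norm_nonneg _) h2 2).trans ?_
  refine sq_sum_le_card_mul_sum_sq.trans_eq ?_
  simp [momentWeight, sq_abs]

lemma momentWeight_nonneg {p : ℕ} [Fact p.Prime] (B ν : ℕ) (x : ZMod p) :
    0 ≤ momentWeight p B ν x := Finset.sum_nonneg fun _ _ => sq_nonneg _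

lemma card_pairs_sum_eq_le (B n : ℕ) :
    (Finset.univ.filter fun c : (Fin (n + 1) → Fin B) × (Fin (n + 1) → Fin B) =>
      ∑ i, (c.1 i : ℕ) = ∑ i, (c.2 i : ℕ)).card ≤ B ^ (2 * n + 1) := by
  have : Fintype.card ((Fin (n + 1) → Fin B) × (Fin n → Fin B)) = B ^ (2 * n + 1) := by
    simp only [Fintype.card_prod, Fintype.card_fun, Fintype.card_fin]
    ring
  rw [← this]
  refine Finset.card_le_card_of_injOn (fun c => (c.1, Fin.tail c.2)) (fun _ _ => Finset.mem_univ _)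
    ?_
  rintro ⟨b, c⟩ h ⟨b', c'⟩ h' heq
  simp only [Finset.coe_filter, Finset.mem_univ, true_and, Set.mem_ofPred_eq, Prod.mk.injEq] at *
  obtain ⟨rfl, ht⟩ := heq
  refine ⟨rfl, ?_⟩
  rw [Fin.sum_univ_succ (fun i => (c i : ℕ))] at h
  rw [Fin.sum_univ_succ (fun i => (c' i : ℕ))] at h'
  have ht' : ∀ i : Fin n, c i.succ = c' i.succ := fun i => congrFun ht i
  have h0 : c 0 = c' 0 := by
    simp only [ht'] at h
    exact Fin.ext (by omega)
  funext i
  refine Fin.cases h0 ht' i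

lemma card_even_multiplicities_le (B ν : ℕ) (hB : 1 ≤ B) {ι : Type*} [Fintype ι] [DecidableEq ι]
    (hι : Fintype.card ι = 2 * ν) :
    (Finset.univ.filter fun h : ι → Fin B =>
      ∀ r, Even (Finset.univ.filter fun i => h i = r).card).card ≤ B ^ ν * ν ^ (2 * ν) := by
  have hc : Fintype.card ((Fin ν → Fin B) × (ι → Fin ν)) = B ^ ν * ν ^ (2 * ν) := by
    simp [hι]
  rw [← hc, ← Finset.card_univ]
  refine (Finset.card_le_card ?_).trans
    (Finset.card_image_le (f := fun q : (Fin ν → Fin B) × (ι → Fin ν) => q.1 ∘ q.2))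
  intro h hh
  have hev := (Finset.mem_filter.1 hh).2
  have h1 : (Finset.univ.image h).card ≤ ν := by
    have h2 := Finset.card_eq_sum_card_image h Finset.univ
    rw [Finset.card_univ, hι] at h2
    have h3 : ∑ r ∈ Finset.univ.image h, 2 ≤
        ∑ r ∈ Finset.univ.image h, (Finset.univ.filter fun i => h i = r).card := by
      refine Finset.sum_le_sum fun r hr => ?_
      obtain ⟨i, _, hi⟩ := Finset.mem_image.1 hr
      have hpos : 0 < (Finset.univ.filter fun i => h i = r).card :=
        Finset.card_pos.2 ⟨i, by simp [hi]⟩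
      obtain ⟨k, hk⟩ := hev r
      omega
    rw [← h2] at h3
    simp only [Finset.sum_const, smul_eq_mul] at h3
    omega
  have : Nonempty (Finset.univ.image h ↪ Fin ν) := by
    apply Function.Embedding.nonempty_of_card_le
    rwa [Fintype.card_coe, Fintype.card_fin]
  obtain ⟨e⟩ := this
  have : NeZero B := ⟨by omega⟩
  refine Finset.mem_image.2 ⟨(fun k => if hk : ∃ r, e r = k then hk.choose else 0,
    fun i => e ⟨h i, Finset.mem_image_of_mem _ (Finset.mem_univ _)⟩), Finset.mem_univ _, ?_⟩
  funext i
  set r₀ : Finset.univ.image h := ⟨h i, Finset.mem_image_of_mem _ (Finset.mem_univ _)⟩ with hr₀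
  have hk : ∃ r, e r = e r₀ := ⟨_, rfl⟩
  simp only [Function.comp_apply]
  rw [dif_pos hk, e.injective hk.choose_spec]

lemma sum_momentWeight_le {p : ℕ} [Fact p.Prime] (hp : p ≠ 2) {B ν : ℕ} (hν : 1 ≤ ν) (hB : 1 ≤ B)
    (hBp : B ≤ p) :
    ((∑ x : ZMod p, momentWeight p B ν x : ℤ) : ℝ) ≤
      (ν : ℝ) ^ (2 * ν) * B ^ ν * p + 70 * ν * B ^ (2 * ν - 1) * √p := by
  set χ := quadraticChar (ZMod p) with hχ
  set V := Fin ν → Fin B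
  set G : ZMod p → V × V → ℤ := fun x c =>
    (∏ i, χ (x + ((c.1 i : ℕ) : ZMod p))) * ∏ i, χ (x + ((c.2 i : ℕ) : ZMod p)) with hG
  set S := Finset.univ.filter fun c : V × V => ∑ i, (c.1 i : ℕ) = ∑ i, (c.2 i : ℕ) with hS
  have h1 : ∀ x, momentWeight p B ν x = ∑ c ∈ S, G x c := by
    intro x
    rw [← Finset.sum_fiberwise_of_maps_to (s := S) (t := Finset.range (ν * B))
        (g := fun c : V × V => ∑ i, (c.1 i : ℕ))
        (fun c _ => Finset.mem_range.2 (sum_lt_mul hν c.1)), momentWeight]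
    refine Finset.sum_congr rfl fun k _ => ?_
    rw [shiftCoeff, sq, Finset.sum_mul_sum, ← Finset.sum_product']
    refine Finset.sum_congr ?_ fun _ _ => rfl
    ext c
    simp only [Finset.mem_product, Finset.mem_filter, Finset.mem_univ, true_and, hS]
    constructor
    · rintro ⟨h1, h2⟩
      exact ⟨h1.trans h2.symm, h1⟩
    · rintro ⟨h1, h2⟩
      exact ⟨h2, h1 ▸ h2⟩
  set bad := Finset.univ.filter fun c : V × V =>
    ∀ r, Even (Finset.univ.filter fun i => Sum.elim c.1 c.2 i = r).card with hbad
  have hbadcard : bad.card ≤ B ^ ν * ν ^ (2 * ν) := by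
    refine le_trans ?_ (card_even_multiplicities_le B ν hB (ι := Fin ν ⊕ Fin ν)
      (by simp [two_mul]))
    refine Finset.card_le_card_of_injOn (fun c => Sum.elim c.1 c.2) (fun c hc => ?_) ?_
    · simpa [hbad] using hc
    · rintro ⟨a, b⟩ _ ⟨a', b'⟩ _ h
      have h' := h
      simp only [Sum.elim_eq_iff] at h'
      exact Prod.ext h'.1 h'.2
  have hScard : S.card ≤ B ^ (2 * ν - 1) := by
    obtain ⟨n, rfl⟩ : ∃ n, ν = n + 1 := ⟨ν - 1, by omega⟩
    exact card_pairs_sum_eq_le B n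
  have habs : ∀ v : ZMod p, |χ v| ≤ 1 := by
    intro v
    by_cases hv : v = 0
    · simp [hv, hχ]
    · rcases quadraticChar_dichotomy hv with h | h <;> simp [hχ, h]
  have hGeq : ∀ x c, G x c = ∏ i, χ (x + (((Sum.elim c.1 c.2 i : Fin B) : ℕ) : ZMod p)) := by
    intro x c
    rw [Fintype.prod_sum_type]
    rfl
  have htriv : ∀ c, ((∑ x, G x c : ℤ) : ℝ) ≤ p := by
    intro c
    have : ∑ x, G x c ≤ ∑ x : ZMod p, 1 := by
      refine Finset.sum_le_sum fun x _ => (le_abs_self _).trans ?_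
      rw [hGeq, Finset.abs_prod]
      exact Finset.prod_le_one (fun _ _ => abs_nonneg _) fun _ _ => habs _
    simp only [Finset.sum_const, Finset.card_univ, ZMod.card, nsmul_eq_mul, mul_one] at this
    exact_mod_cast this
  have hcast : ∀ a b : Fin B, ((a : ℕ) : ZMod p) = ((b : ℕ) : ZMod p) ↔ a = b := by
    intro a b
    rw [ZMod.natCast_eq_natCast_iff', Nat.mod_eq_of_lt (a.2.trans_le hBp),
      Nat.mod_eq_of_lt (b.2.trans_le hBp), Fin.ext_iff]
  have hgood : ∀ c, c ∉ bad → ((∑ x, G x c : ℤ) : ℝ) ≤ 70 * ν * √p := by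
    intro c hc
    simp only [hbad, Finset.mem_filter, Finset.mem_univ, true_and, not_forall,
      Nat.not_even_iff_odd] at hc
    obtain ⟨r, hr⟩ := hc
    have := abs_sum_prod_quadraticChar_le hp (ι := Fin ν ⊕ Fin ν) (n := 2 * ν) (by simp [two_mul])
      (even_two_mul ν) (fun i => (((Sum.elim c.1 c.2 i : Fin B) : ℕ) : ZMod p))
      ⟨((r : ℕ) : ZMod p), by simpa only [hcast] using hr⟩
    simp only [← hχ, ← hGeq] at this
    refine (le_abs_self _).trans (this.trans_eq ?_)
    push_cast
    ring
  have h2 : ((∑ x : ZMod p, momentWeight p B ν x : ℤ) : ℝ) =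
      ∑ c ∈ S, ((∑ x, G x c : ℤ) : ℝ) := by
    simp only [h1]
    rw [Finset.sum_comm, Int.cast_sum]
  rw [h2, ← Finset.sum_filter_add_sum_filter_not S (fun c => c ∈ bad)]
  refine add_le_add ?_ ?_
  · calc _ ≤ ∑ c ∈ S.filter (fun c => c ∈ bad), (p : ℝ) := Finset.sum_le_sum fun c _ => htriv c
      _ = ((S.filter (fun c => c ∈ bad)).card : ℝ) * p := by simp
      _ ≤ ((B ^ ν * ν ^ (2 * ν) : ℕ) : ℝ) * p := by
        gcongr
        refine le_trans (Finset.card_le_card fun c hc => (Finset.mem_filter.1 hc).2) hbadcard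
      _ = _ := by push_cast; ring
  · calc _ ≤ ∑ c ∈ S.filter (fun c => c ∉ bad), (70 * ν * √p : ℝ) :=
          Finset.sum_le_sum fun c hc => hgood c (Finset.mem_filter.1 hc).2
      _ = ((S.filter (fun c => c ∉ bad)).card : ℝ) * (70 * ν * √p) := by simp
      _ ≤ ((B ^ (2 * ν - 1) : ℕ) : ℝ) * (70 * ν * √p) := by
        gcongr
        exact (Finset.card_filter_le _ _).trans hScard
      _ = _ := by push_cast; ring

end Moment

section Counting

lemma card_congruent_le (s : Finset ℕ) (M e : ℕ) (hs : ∀ l ∈ s, l < M)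
    (hcong : ∀ l ∈ s, ∀ l' ∈ s, l ≡ l' [MOD e]) : s.card ≤ M / e + 1 := by
  rw [← Finset.card_range (M / e + 1)]
  refine Finset.card_le_card_of_injOn (fun l => l / e) (fun l hl => ?_) fun l hl l' hl' h => ?_
  · simp only [Finset.coe_range, Set.mem_Iio]
    exact Nat.lt_succ_of_le (Nat.div_le_div_right (hs l hl).le)
  · have h1 : l % e = l' % e := hcong l hl l' hl'
    have h2 : l / e = l' / e := h
    rw [← Nat.div_add_mod l e, ← Nat.div_add_mod l' e, h1, h2]

lemma card_quotient_eq_le {p : ℕ} [Fact p.Prime] (N : ℤ) {A M a a' : ℕ} (hAM : 2 * A * M ≤ p)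
    (hM : 1 ≤ M)
    (ha : a ∈ Finset.Icc 1 A) (ha' : a' ∈ Finset.Icc 1 A) :
    (((Finset.range M ×ˢ Finset.range M).filter fun l : ℕ × ℕ =>
      ((N + l.1 : ℤ) : ZMod p) * (a : ZMod p)⁻¹ =
        ((N + l.2 : ℤ) : ZMod p) * (a' : ZMod p)⁻¹).card : ℝ) ≤ 1 + M * (Nat.gcd a a' / a) := by
  rw [Finset.mem_Icc] at ha ha'
  set X := (Finset.range M ×ˢ Finset.range M).filter fun l : ℕ × ℕ =>
      ((N + l.1 : ℤ) : ZMod p) * (a : ZMod p)⁻¹ =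
        ((N + l.2 : ℤ) : ZMod p) * (a' : ZMod p)⁻¹ with hX
  have hAp : A < p := by nlinarith
  have hunit : ∀ c : ℕ, 1 ≤ c → c ≤ A → (c : ZMod p) ≠ 0 := by
    intro c h1 h2 h
    rw [ZMod.natCast_eq_zero_iff] at h
    have := Nat.le_of_dvd h1 h
    omega
  have hua := hunit a ha.1 ha.2
  have hua' := hunit a' ha'.1 ha'.2
  have key : ∀ l ∈ X, ∀ k ∈ X, ((l.1 : ℤ) - k.1) * a' = ((l.2 : ℤ) - k.2) * a := by
    intro l hl k hk
    simp only [hX, Finset.mem_filter, Finset.mem_product, Finset.mem_range] at hl hk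
    obtain ⟨⟨hl1, hl2⟩, hl⟩ := hl
    obtain ⟨⟨hk1, hk2⟩, hk⟩ := hk
    have hl' : ((N + l.1 : ℤ) : ZMod p) * a' = ((N + l.2 : ℤ) : ZMod p) * a := by
      field_simp at hl
      linear_combination hl
    have hk' : ((N + k.1 : ℤ) : ZMod p) * a' = ((N + k.2 : ℤ) : ZMod p) * a := by
      field_simp at hk
      linear_combination hk
    have hmod : ((((l.1 : ℤ) - k.1) * a' - ((l.2 : ℤ) - k.2) * a : ℤ) : ZMod p) = 0 := by
      push_cast at hl' hk' ⊢
      linear_combination hl' - hk'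
    rw [ZMod.intCast_zmod_eq_zero_iff_dvd] at hmod
    have hb : ∀ u v c : ℕ, u < M → v < M → c ≤ A → |((u : ℤ) - v) * c| ≤ (M - 1) * A := by
      intro u v c hu hv hc
      rw [abs_mul]
      refine mul_le_mul ?_ ?_ (abs_nonneg _) (by omega)
      · rw [abs_le]; omega
      · rw [abs_le]; omega
    have h1 := hb l.1 k.1 a' hl1 hk1 ha'.2
    have h2 := hb l.2 k.2 a hl2 hk2 ha.2
    have h3 : |((l.1 : ℤ) - k.1) * a' - ((l.2 : ℤ) - k.2) * a| < p := by
      refine (abs_sub _ _).trans_lt ?_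
      have h4 : (2 : ℤ) * A * M ≤ p := by exact_mod_cast hAM
      have h5 : (1 : ℤ) ≤ A := by omega
      nlinarith
    exact sub_eq_zero.1 (Int.eq_zero_of_abs_lt_dvd hmod h3)
  set g := Nat.gcd a a' with hg
  have hgpos : 0 < g := Nat.gcd_pos_of_pos_left _ ha.1
  obtain ⟨e, he⟩ := Nat.gcd_dvd_left a a'
  obtain ⟨e', he'⟩ := Nat.gcd_dvd_right a a'
  rw [← hg] at he he'
  have hepos : 0 < e := by
    rcases Nat.eq_zero_or_pos e with h | h
    · rw [h] at he; omega
    · exact h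
  have hcop : Nat.Coprime e e' := by
    have := Nat.coprime_div_gcd_div_gcd (m := a) (n := a') hgpos
    rwa [← hg, Nat.div_eq_of_eq_mul_right hgpos he, Nat.div_eq_of_eq_mul_right hgpos he'] at this
  have hinj : Set.InjOn Prod.fst (X : Set (ℕ × ℕ)) := by
    intro l hl k hk h
    have h1 := key l hl k hk
    rw [h, sub_self, zero_mul] at h1
    have ha0 : (a : ℤ) ≠ 0 := by omega
    have h2 := (mul_eq_zero.1 h1.symm).resolve_right ha0
    exact Prod.ext h (by omega)
  have hcard : X.card ≤ M / e + 1 := by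
    rw [← Finset.card_image_of_injOn hinj]
    refine card_congruent_le _ M e ?_ ?_
    · intro l hl
      obtain ⟨k, hk, rfl⟩ := Finset.mem_image.1 hl
      simp only [hX, Finset.mem_filter, Finset.mem_product, Finset.mem_range] at hk
      exact hk.1.1
    · intro _ hl' _ hk'
      obtain ⟨l, hl, rfl⟩ := Finset.mem_image.1 hl'
      obtain ⟨k, hk, rfl⟩ := Finset.mem_image.1 hk'
      have h1 := key k hk l hl
      rw [he, he'] at h1
      push_cast at h1
      have hg0 : (g : ℤ) ≠ 0 := by omega
      have h2 : ((k.1 : ℤ) - l.1) * e' = ((k.2 : ℤ) - l.2) * e := by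
        apply mul_left_cancel₀ hg0
        linear_combination h1
      rw [Nat.modEq_iff_dvd]
      have h3 : (e : ℤ) ∣ ((k.1 : ℤ) - l.1) * e' := ⟨(k.2 : ℤ) - l.2, by rw [h2]; ring⟩
      exact (Nat.isCoprime_iff_coprime.2 hcop).dvd_of_dvd_mul_right h3
  have hge : (g : ℝ) / a = 1 / e := by
    rw [he]
    have : (g : ℝ) ≠ 0 := by positivity
    push_cast
    field_simp
  rw [hge]
  have h5 : ((M / e : ℕ) : ℝ) ≤ M / e := Nat.cast_div_le
  calc (X.card : ℝ) ≤ ((M / e : ℕ) : ℝ) + 1 := by exact_mod_cast hcard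
    _ ≤ M / e + 1 := by gcongr
    _ = 1 + M * (1 / e) := by ring

lemma sum_inv_multiples_le (A d : ℕ) (hd : 1 ≤ d) :
    ∑ a ∈ Finset.Icc 1 A with d ∣ a, (a : ℝ)⁻¹ ≤ (d : ℝ)⁻¹ * ∑ e ∈ Finset.Icc 1 A, (e : ℝ)⁻¹ := by
  calc ∑ a ∈ Finset.Icc 1 A with d ∣ a, (a : ℝ)⁻¹
      ≤ ∑ a ∈ (Finset.Icc 1 A).image (fun e => d * e), (a : ℝ)⁻¹ := by
        refine Finset.sum_le_sum_of_subset_of_nonneg ?_ fun _ _ _ => by positivity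
        intro a ha
        simp only [Finset.mem_filter, Finset.mem_Icc] at ha
        obtain ⟨⟨h1, h2⟩, e, rfl⟩ := ha
        refine Finset.mem_image.2 ⟨e, Finset.mem_Icc.2 ⟨?_, ?_⟩, rfl⟩
        · exact Nat.pos_of_ne_zero fun h => by simp [h] at h1
        · exact (Nat.le_mul_of_pos_left e hd).trans h2
    _ = ∑ e ∈ Finset.Icc 1 A, ((d * e : ℕ) : ℝ)⁻¹ :=
        Finset.sum_image fun x _ y _ h => Nat.eq_of_mul_eq_mul_left hd h
    _ = _ := by
        rw [Finset.mul_sum]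
        exact Finset.sum_congr rfl fun e _ => by push_cast; rw [mul_inv]

lemma sum_gcd_div_le (A : ℕ) :
    ∑ a ∈ Finset.Icc 1 A, ∑ a' ∈ Finset.Icc 1 A, (Nat.gcd a a' : ℝ) / a ≤
      A * (∑ e ∈ Finset.Icc 1 A, (e : ℝ)⁻¹) ^ 2 := by
  set H := ∑ e ∈ Finset.Icc 1 A, (e : ℝ)⁻¹ with hH
  have hH0 : 0 ≤ H := Finset.sum_nonneg fun _ _ => by positivity
  have h1 : ∀ a ∈ Finset.Icc 1 A, ∀ a' ∈ Finset.Icc 1 A, (Nat.gcd a a' : ℝ) / a ≤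
      ∑ d ∈ Finset.Icc 1 A, (if d ∣ a then (a : ℝ)⁻¹ else 0) * ((if d ∣ a' then 1 else 0) * d) := by
    intro a ha a' _
    rw [Finset.mem_Icc] at ha
    have hg : Nat.gcd a a' ∈ Finset.Icc 1 A := Finset.mem_Icc.2
      ⟨Nat.gcd_pos_of_pos_left _ ha.1, (Nat.gcd_le_left _ ha.1).trans ha.2⟩
    refine le_trans (le_of_eq ?_) (Finset.single_le_sum (fun d _ => ?_) hg)
    · rw [if_pos (Nat.gcd_dvd_left a a'), if_pos (Nat.gcd_dvd_right a a')]
      ring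
    · positivity
  calc _ ≤ ∑ a ∈ Finset.Icc 1 A, ∑ a' ∈ Finset.Icc 1 A, ∑ d ∈ Finset.Icc 1 A,
        (if d ∣ a then (a : ℝ)⁻¹ else 0) * ((if d ∣ a' then 1 else 0) * d) :=
        Finset.sum_le_sum fun a ha => Finset.sum_le_sum fun a' ha' => h1 a ha a' ha'
    _ = ∑ d ∈ Finset.Icc 1 A, (∑ a ∈ Finset.Icc 1 A with d ∣ a, (a : ℝ)⁻¹) *
        (((Finset.Icc 1 A).filter (fun a' => d ∣ a')).card * d) := by
        simp_rw [Finset.sum_comm (t := Finset.Icc 1 A) (s := Finset.Icc 1 A) (f := fun a' d =>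
          (if d ∣ _ then _ else _) * ((if d ∣ a' then _ else _) * _))]
        rw [Finset.sum_comm]
        refine Finset.sum_congr rfl fun d _ => ?_
        rw [Finset.sum_filter, ← Finset.sum_boole,
          Finset.sum_mul (f := fun x => if d ∣ x then (1 : ℝ) else 0), Finset.sum_mul_sum]
    _ ≤ ∑ d ∈ Finset.Icc 1 A, ((d : ℝ)⁻¹ * H) * A := by
        refine Finset.sum_le_sum fun d hd => ?_
        have hd1 := (Finset.mem_Icc.1 hd).1
        refine mul_le_mul (sum_inv_multiples_le A d hd1) ?_ (by positivity) (by positivity)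
        have h2 : ((Finset.Icc 1 A).filter (fun a' => d ∣ a')).card = A / d := by
          rw [← Nat.Ioc_filter_dvd_card_eq_div]
          rfl
        rw [h2]
        exact_mod_cast Nat.div_mul_le_self A d
    _ = A * H ^ 2 := by
        rw [← Finset.sum_mul, ← Finset.sum_mul, ← hH]
        ring

/-- The number of ways to write `x` as `(N + l) / a` modulo `p`, `l < M`, `1 ≤ a ≤ A`. -/
noncomputable def quotientCount (p : ℕ) (N : ℤ) (A M : ℕ) (x : ZMod p) : ℕ :=
  ((Finset.Icc 1 A ×ˢ Finset.range M).filter fun q : ℕ × ℕ =>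
    ((N + q.2 : ℤ) : ZMod p) * (q.1 : ZMod p)⁻¹ = x).card

lemma sum_quotientCount {p : ℕ} [Fact p.Prime] (N : ℤ) (A M : ℕ) :
    ∑ x : ZMod p, quotientCount p N A M x = A * M := by
  have := Finset.card_eq_sum_card_fiberwise (s := Finset.Icc 1 A ×ˢ Finset.range M)
    (t := Finset.univ) (f := fun q : ℕ × ℕ => ((N + q.2 : ℤ) : ZMod p) * (q.1 : ZMod p)⁻¹)
    (fun _ _ => Finset.mem_coe.2 (Finset.mem_univ _))
  rw [Finset.card_product, Nat.card_Icc, Finset.card_range, Nat.add_sub_cancel] at this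
  exact this.symm

lemma sum_quotientCount_sq_le {p : ℕ} [Fact p.Prime] (N : ℤ) {A M : ℕ} (hAM : 2 * A * M ≤ p)
    (hA : 1 ≤ A) (hle : A ≤ M) :
    ∑ x : ZMod p, (quotientCount p N A M x : ℝ) ^ 2 ≤ 2 * A * M * (1 + Real.log A) ^ 2 := by
  set H := ∑ e ∈ Finset.Icc 1 A, (e : ℝ)⁻¹ with hH
  have hHlog : H ≤ 1 + Real.log A := by
    have := harmonic_le_one_add_log A
    rw [harmonic_eq_sum_Icc] at this
    push_cast at this
    exact this
  have hH1 : 1 ≤ H := by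
    have := Finset.single_le_sum (f := fun e : ℕ => (e : ℝ)⁻¹) (s := Finset.Icc 1 A)
      (fun _ _ => by positivity) (Finset.mem_Icc.2 ⟨le_refl 1, hA⟩)
    simpa using this
  have h1 : ∀ x : ZMod p, (quotientCount p N A M x : ℝ) = ∑ a ∈ Finset.Icc 1 A,
      ∑ l ∈ Finset.range M, if ((N + l : ℤ) : ZMod p) * (a : ZMod p)⁻¹ = x then 1 else 0 := by
    intro x
    rw [quotientCount, ← Finset.sum_boole, Finset.sum_product]
  have h2 : ∑ x : ZMod p, (quotientCount p N A M x : ℝ) ^ 2 =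
      ∑ a ∈ Finset.Icc 1 A, ∑ a' ∈ Finset.Icc 1 A,
        (((Finset.range M ×ˢ Finset.range M).filter fun l : ℕ × ℕ =>
          ((N + l.1 : ℤ) : ZMod p) * (a : ZMod p)⁻¹ =
            ((N + l.2 : ℤ) : ZMod p) * (a' : ZMod p)⁻¹).card : ℝ) := by
    simp_rw [h1, sq, Finset.sum_mul_sum]
    rw [Finset.sum_comm]
    refine Finset.sum_congr rfl fun a _ => ?_
    rw [Finset.sum_comm]
    refine Finset.sum_congr rfl fun a' _ => ?_
    rw [← Finset.sum_boole, Finset.sum_product, Finset.sum_comm]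
    refine Finset.sum_congr rfl fun l _ => ?_
    rw [Finset.sum_comm]
    refine Finset.sum_congr rfl fun l' _ => ?_
    simp [eq_comm]
  rw [h2]
  calc _ ≤ ∑ a ∈ Finset.Icc 1 A, ∑ a' ∈ Finset.Icc 1 A, (1 + M * ((Nat.gcd a a' : ℝ) / a)) :=
        Finset.sum_le_sum fun a ha => Finset.sum_le_sum fun a' ha' =>
          card_quotient_eq_le N hAM (hA.trans hle) ha ha'
    _ = A * A + M * ∑ a ∈ Finset.Icc 1 A, ∑ a' ∈ Finset.Icc 1 A, (Nat.gcd a a' : ℝ) / a := by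
        simp only [Finset.sum_add_distrib, Finset.mul_sum]
        simp
    _ ≤ A * A + M * (A * H ^ 2) := by
        exact add_le_add_right (mul_le_mul_of_nonneg_left (sum_gcd_div_le A) (by positivity)) _
    _ ≤ A * M * H ^ 2 + M * (A * H ^ 2) := by
        refine add_le_add_left ?_ _
        have : (A : ℝ) ≤ M := by exact_mod_cast hle
        calc (A : ℝ) * A ≤ A * M * 1 := by rw [mul_one]; gcongr
          _ ≤ A * M * H ^ 2 := by gcongr; exact one_le_pow₀ hH1
    _ = 2 * A * M * H ^ 2 := by ring
    _ ≤ _ := by gcongr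

end Counting

/-- The quadratic character twisted by an additive character, summed over `N ≤ m < N + M`. -/
noncomputable def twistedSum (p : ℕ) [Fact p.Prime] (ψ : AddChar (ZMod p) ℂ) (N : ℤ) (M : ℕ) : ℂ :=
  ∑ l ∈ Finset.range M, (quadraticChar (ZMod p) ((N + l : ℤ) : ZMod p) : ℂ) *
    ψ ((N + l : ℤ) : ZMod p)

section Burgess

lemma norm_quadraticChar_le {p : ℕ} [Fact p.Prime] (v : ZMod p) :
    ‖(quadraticChar (ZMod p) v : ℂ)‖ ≤ 1 := by
  by_cases hv : v = 0
  · simp [hv]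
  · rcases quadraticChar_dichotomy hv with h | h <;> simp [h]

lemma norm_twistedSum_le {p : ℕ} [Fact p.Prime] (ψ : AddChar (ZMod p) ℂ) (N : ℤ) (M : ℕ) :
    ‖twistedSum p ψ N M‖ ≤ M := by
  refine (norm_sum_le _ _).trans ?_
  calc _ ≤ ∑ l ∈ Finset.range M, (1 : ℝ) := Finset.sum_le_sum fun l _ => by
        rw [norm_mul, AddChar.norm_apply, mul_one]
        exact norm_quadraticChar_le _
    _ = M := by simp

lemma twistedSum_add {p : ℕ} [Fact p.Prime] (ψ : AddChar (ZMod p) ℂ) (N : ℤ) (M h : ℕ) :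
    twistedSum p ψ N (M + h) = twistedSum p ψ N M + twistedSum p ψ (N + M) h := by
  rw [twistedSum, Finset.sum_range_add]
  simp only [twistedSum, Nat.cast_add, add_assoc]

lemma norm_twistedSum_sub_shift_le {p : ℕ} [Fact p.Prime] (ψ : AddChar (ZMod p) ℂ) (N : ℤ)
    (M h : ℕ) {E : ℝ} (hE : ∀ N, ‖twistedSum p ψ N h‖ ≤ E) :
    ‖twistedSum p ψ N M - twistedSum p ψ (N + h) M‖ ≤ 2 * E := by
  have h1 := twistedSum_add ψ N M h
  rw [add_comm M h, twistedSum_add ψ N h M] at h1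
  have h2 : twistedSum p ψ N M - twistedSum p ψ (N + h) M =
      twistedSum p ψ N h - twistedSum p ψ (N + M) h := by linear_combination -h1
  rw [h2, two_mul]
  exact (norm_sub_le _ _).trans (add_le_add (hE _) (hE _))

lemma norm_sum_shifts_le {p : ℕ} [Fact p.Prime] (ψ : AddChar (ZMod p) ℂ) (N : ℤ) {A B M : ℕ}
    (hA : A < p) (W : ZMod p → ℝ)
    (hW : ∀ x, ∀ z : ℂ, ‖z‖ = 1 →
      ‖∑ b : Fin B, (quadraticChar (ZMod p) (x + ((b : ℕ) : ZMod p)) : ℂ) * z ^ (b : ℕ)‖ ≤ W x) :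
    ‖∑ a ∈ Finset.Icc 1 A, ∑ b : Fin B, twistedSum p ψ (N + (a * b : ℕ)) M‖ ≤
      ∑ x, quotientCount p N A M x * W x := by
  set χ := quadraticChar (ZMod p) with hχ
  have hterm : ∀ a ∈ Finset.Icc 1 A, ∀ l : ℕ,
      ‖∑ b : Fin B, (χ ((N + (a * b : ℕ) + l : ℤ) : ZMod p) : ℂ) *
        ψ ((N + (a * b : ℕ) + l : ℤ) : ZMod p)‖ ≤
      W (((N + l : ℤ) : ZMod p) * (a : ZMod p)⁻¹) := by
    intro a ha l
    rw [Finset.mem_Icc] at ha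
    have ha0 : (a : ZMod p) ≠ 0 := by
      rw [Ne, ZMod.natCast_eq_zero_iff]
      intro h
      have := Nat.le_of_dvd ha.1 h
      omega
    have h1 : ∀ b : Fin B, (χ ((N + (a * b : ℕ) + l : ℤ) : ZMod p) : ℂ) *
        ψ ((N + (a * b : ℕ) + l : ℤ) : ZMod p) =
        ((χ a : ℂ) * ψ ((N + l : ℤ) : ZMod p)) *
        ((χ (((N + l : ℤ) : ZMod p) * (a : ZMod p)⁻¹ + ((b : ℕ) : ZMod p)) : ℂ) *
          ψ a ^ (b : ℕ)) := by
      intro b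
      have h2 : ((N + (a * b : ℕ) + l : ℤ) : ZMod p) =
          a * (((N + l : ℤ) : ZMod p) * (a : ZMod p)⁻¹ + ((b : ℕ) : ZMod p)) := by
        field_simp
        push_cast
        ring
      have h3 : ((N + (a * b : ℕ) + l : ℤ) : ZMod p) =
          ((N + l : ℤ) : ZMod p) + (b : ℕ) • (a : ZMod p) := by
        rw [nsmul_eq_mul]
        push_cast
        ring
      nth_rewrite 1 [h2]
      rw [h3, map_mul, AddChar.map_add_eq_mul, AddChar.map_nsmul_eq_pow, Int.cast_mul]
      ring
    rw [Finset.sum_congr rfl fun b _ => h1 b, ← Finset.mul_sum, norm_mul, norm_mul,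
      AddChar.norm_apply, mul_one]
    refine (mul_le_of_le_one_left (norm_nonneg _) (norm_quadraticChar_le _)).trans ?_
    exact hW _ _ (AddChar.norm_apply _ _)
  have hswap : ∀ a ∈ Finset.Icc 1 A, ‖∑ b : Fin B, twistedSum p ψ (N + (a * b : ℕ)) M‖ ≤
      ∑ l ∈ Finset.range M, W (((N + l : ℤ) : ZMod p) * (a : ZMod p)⁻¹) := by
    intro a ha
    simp only [twistedSum]
    rw [Finset.sum_comm]
    exact (norm_sum_le _ _).trans (Finset.sum_le_sum fun l _ => hterm a ha l)
  refine (norm_sum_le _ _).trans ((Finset.sum_le_sum hswap).trans_eq ?_)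
  rw [← Finset.sum_product (f := fun q : ℕ × ℕ =>
    W (((N + q.2 : ℤ) : ZMod p) * (q.1 : ZMod p)⁻¹)),
    ← Finset.sum_fiberwise (g := fun q : ℕ × ℕ => ((N + q.2 : ℤ) : ZMod p) * (q.1 : ZMod p)⁻¹)]
  refine Finset.sum_congr rfl fun x _ => ?_
  rw [Finset.sum_congr rfl fun q hq => by rw [(Finset.mem_filter.1 hq).2], Finset.sum_const,
    nsmul_eq_mul, quotientCount]

lemma sum_mul_pow_two_mul_le {ι : Type*} [Fintype ι] (V W : ι → ℝ) (hV : ∀ i, 0 ≤ V i)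
    (hW : ∀ i, 0 ≤ W i) {ν : ℕ} (hν : 1 ≤ ν) (hpos : 0 < ∑ i, V i) :
    (∑ i, V i * W i) ^ (2 * ν) ≤
      (∑ i, V i) ^ (2 * ν - 2) * (∑ i, V i ^ 2) * ∑ i, W i ^ (2 * ν) := by
  set s := ∑ i, V i with hs
  have h1 : (∑ i, V i * W i) ^ ν ≤ s ^ (ν - 1) * ∑ i, V i * W i ^ ν := by
    have h2 := Real.pow_arith_mean_le_arith_mean_pow Finset.univ (fun i => V i / s) W
      (fun i _ => div_nonneg (hV i) hpos.le) (by rw [← Finset.sum_div, div_self hpos.ne'])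
      (fun i _ => hW i) ν
    have h3 : ∀ U : ι → ℝ, ∑ i, V i / s * U i = (∑ i, V i * U i) / s := by
      intro U
      rw [Finset.sum_div]
      exact Finset.sum_congr rfl fun i _ => by ring
    rw [h3 W, h3 fun i => W i ^ ν, div_pow, div_le_div_iff₀ (pow_pos hpos _) hpos] at h2
    obtain ⟨n, rfl⟩ : ∃ n, ν = n + 1 := ⟨ν - 1, by omega⟩
    refine le_of_mul_le_mul_right (h2.trans_eq ?_) hpos
    rw [Nat.add_sub_cancel]
    ring
  have h0 : 0 ≤ ∑ i, V i * W i := Finset.sum_nonneg fun i _ => mul_nonneg (hV i) (hW i)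
  calc (∑ i, V i * W i) ^ (2 * ν) = ((∑ i, V i * W i) ^ ν) ^ 2 := by rw [mul_comm, pow_mul]
    _ ≤ (s ^ (ν - 1) * ∑ i, V i * W i ^ ν) ^ 2 := by gcongr
    _ = s ^ (2 * ν - 2) * (∑ i, V i * W i ^ ν) ^ 2 := by
      rw [mul_pow, ← pow_mul]
      congr 2
      omega
    _ ≤ s ^ (2 * ν - 2) * ((∑ i, V i ^ 2) * ∑ i, (W i ^ ν) ^ 2) := by
      gcongr
      exact Finset.sum_mul_sq_le_sq_mul_sq _ _ _
    _ = _ := by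
      simp only [← pow_mul, mul_comm ν 2]
      ring

/-- The averaged shifts are bounded by the moments of short character sums. -/
lemma norm_sum_shifts_pow_le {p : ℕ} [Fact p.Prime] (hp : p ≠ 2) (ψ : AddChar (ZMod p) ℂ) (N : ℤ)
    {A B M ν : ℕ} (hν : 1 ≤ ν) (hA : 1 ≤ A) (hAM : A ≤ M) (hAMp : 2 * A * M ≤ p) (hB : 1 ≤ B)
    (hBp : B ≤ p) :
    ‖∑ a ∈ Finset.Icc 1 A, ∑ b : Fin B, twistedSum p ψ (N + (a * b : ℕ)) M‖ ^ (2 * ν) ≤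
      ((A : ℝ) * M) ^ (2 * ν - 2) * (2 * A * M * (1 + Real.log A) ^ 2) *
        (ν * B * ((ν : ℝ) ^ (2 * ν) * B ^ ν * p + 70 * ν * B ^ (2 * ν - 1) * √p)) := by
  set W : ZMod p → ℝ := fun x =>
    (ν * B * momentWeight p B ν x : ℝ) ^ (((2 * ν : ℕ) : ℝ)⁻¹) with hWdef
  have hnn : ∀ x : ZMod p, (0 : ℝ) ≤ ν * B * momentWeight p B ν x := fun x =>
    mul_nonneg (by positivity) (by exact_mod_cast momentWeight_nonneg B ν x)
  have hW0 : ∀ x, 0 ≤ W x := fun x => Real.rpow_nonneg (hnn x) _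
  have hWpow : ∀ x, W x ^ (2 * ν) = ν * B * momentWeight p B ν x := fun x =>
    Real.rpow_inv_natCast_pow (hnn x) (by omega)
  have hAp : A < p := by nlinarith
  have h1 := norm_sum_shifts_le ψ N (M := M) hAp W (B := B) fun x z hz => by
    refine le_of_pow_le_pow_left₀ (n := 2 * ν) (by omega) (hW0 x) ?_
    rw [hWpow]
    exact norm_sum_shift_pow_le hν x z hz
  have hsum : ∑ x : ZMod p, (quotientCount p N A M x : ℝ) = A * M := by
    exact_mod_cast sum_quotientCount N A M
  have hApos : (0 : ℝ) < A := by exact_mod_cast hA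
  have hMpos : (0 : ℝ) < M := by exact_mod_cast hA.trans hAM
  have h2 := sum_mul_pow_two_mul_le (fun x : ZMod p => (quotientCount p N A M x : ℝ)) W
    (fun x => Nat.cast_nonneg _) hW0 hν (by rw [hsum]; positivity)
  rw [hsum] at h2
  refine (pow_le_pow_left₀ (norm_nonneg _) h1 _).trans (h2.trans ?_)
  have h3 : ∑ x, W x ^ (2 * ν) ≤
      ν * B * ((ν : ℝ) ^ (2 * ν) * B ^ ν * p + 70 * ν * B ^ (2 * ν - 1) * √p) := by
    simp only [hWpow]
    rw [← Finset.mul_sum]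
    refine mul_le_mul_of_nonneg_left ?_ (by positivity)
    have := sum_momentWeight_le hp hν hB hBp
    exact_mod_cast this
  have h4 := sum_quotientCount_sq_le N hAMp hA hAM
  have h5 : (0 : ℝ) ≤ ∑ x, W x ^ (2 * ν) := Finset.sum_nonneg fun x _ => pow_nonneg (hW0 x) _
  gcongr

end Burgess

section Induction

/-- The constant produced by the moment estimate. -/
noncomputable def burgessMainConst (ν : ℕ) : ℝ := 512 * (ν * ((ν : ℝ) ^ (2 * ν) + 70 * ν))

lemma le_burgessMainConst {ν : ℕ} (hν : 1 ≤ ν) : 512 ≤ burgessMainConst ν := by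
  have h : (1 : ℝ) ≤ ν := by exact_mod_cast hν
  have h2 : (0 : ℝ) ≤ (ν : ℝ) ^ (2 * ν) := by positivity
  unfold burgessMainConst
  nlinarith

lemma le_of_pow_le_moment {ν : ℕ} (hν : 1 ≤ ν) {S A B M L l s β γ μ : ℝ}
    (hA : 0 < A) (hB : 0 < B) (hM : 0 < M) (hs : 0 ≤ s) (hγ : 0 ≤ γ) (hμ : 0 ≤ μ)
    (hl : 1 ≤ l) (hL : 0 ≤ L) (hLl : L ≤ 2 * l) (hβ : β = γ ^ 2) (hβs : β ^ (ν - 1) = s)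
    (hμM : μ ^ ν = M ^ (ν - 1)) (hβB : β ≤ B) (hBβ : B ≤ 2 * β) (hMA : M ≤ 32 * (A * B))
    (hS : S ^ (2 * ν) ≤ (A * M) ^ (2 * ν - 2) * (2 * A * M * L ^ 2) *
      (ν * B * ((ν : ℝ) ^ (2 * ν) * B ^ ν * s ^ 2 + 70 * ν * B ^ (2 * ν - 1) * s))) :
    S ≤ A * B * (burgessMainConst ν * γ * μ * l) := by
  obtain ⟨k, rfl⟩ : ∃ k, ν = k + 1 := ⟨ν - 1, by omega⟩
  have hc := le_burgessMainConst hν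
  set c := burgessMainConst (k + 1) with hcdef
  simp only [show 2 * (k + 1) - 2 = 2 * k by omega, show 2 * (k + 1) - 1 = 2 * k + 1 by omega,
    Nat.add_sub_cancel] at *
  have hβ0 : 0 ≤ β := by rw [hβ]; positivity
  refine le_of_pow_le_pow_left₀ (n := 2 * (k + 1)) (by omega) (by positivity) (hS.trans ?_)
  set n : ℝ := ((k + 1 : ℕ) : ℝ) with hn
  have hn0 : 0 ≤ n := by positivity
  have hsB : s ≤ B ^ k := hβs ▸ pow_le_pow_left₀ hβ0 hβB k
  have h1 : n * B * (n ^ (2 * (k + 1)) * B ^ (k + 1) * s ^ 2 + 70 * n * B ^ (2 * k + 1) * s) ≤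
      c / 512 * (B ^ (2 * (k + 1)) * s) := by
    have e1 : B ^ (k + 1) * s ^ 2 ≤ B ^ (2 * k + 1) * s := by
      calc B ^ (k + 1) * s ^ 2 = B ^ (k + 1) * s * s := by ring
        _ ≤ B ^ (k + 1) * B ^ k * s := by gcongr
        _ = _ := by ring
    calc _ = n * B *
          (n ^ (2 * (k + 1)) * (B ^ (k + 1) * s ^ 2) + 70 * n * (B ^ (2 * k + 1) * s)) := by
          ring
      _ ≤ n * B * (n ^ (2 * (k + 1)) * (B ^ (2 * k + 1) * s) + 70 * n * (B ^ (2 * k + 1) * s)) := by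
          gcongr
      _ = _ := by rw [hcdef, burgessMainConst, ← hn]; ring
  have h2 : M * L ^ 2 * (2 * (c / 512)) ≤ A * (c ^ (2 * (k + 1)) * γ ^ 2 * l ^ (2 * (k + 1))) := by
    have hcp : c ≤ c ^ (2 * (k + 1)) := le_self_pow₀ (by linarith) (by omega)
    have hlp : l ^ 2 ≤ l ^ (2 * (k + 1)) := pow_le_pow_right₀ hl (by omega)
    have hM2 : M ≤ 64 * (A * β) := by nlinarith
    calc M * L ^ 2 * (2 * (c / 512)) ≤ 64 * (A * β) * (2 * l) ^ 2 * (2 * (c / 512)) := by gcongr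
      _ = A * (c * γ ^ 2 * l ^ 2) := by rw [hβ]; ring
      _ ≤ _ := by gcongr
  have h3 : γ ^ (2 * (k + 1)) = s * γ ^ 2 := by rw [← hβs, hβ]; ring
  have h4 : μ ^ (2 * (k + 1)) = M ^ (2 * k) := by
    rw [mul_comm, pow_mul, hμM, ← pow_mul, mul_comm]
  calc _ ≤ (A * M) ^ (2 * k) * (2 * A * M * L ^ 2) * (c / 512 * (B ^ (2 * (k + 1)) * s)) := by
        gcongr
    _ = A ^ (2 * k + 1) * M ^ (2 * k) * B ^ (2 * (k + 1)) * s * (M * L ^ 2 * (2 * (c / 512))) := by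
        rw [mul_pow]; ring
    _ ≤ A ^ (2 * k + 1) * M ^ (2 * k) * B ^ (2 * (k + 1)) * s *
        (A * (c ^ (2 * (k + 1)) * γ ^ 2 * l ^ (2 * (k + 1)))) := by gcongr
    _ = (A * B) ^ (2 * (k + 1)) * (c ^ (2 * (k + 1)) * (s * γ ^ 2) * M ^ (2 * k) *
        l ^ (2 * (k + 1))) := by
        rw [mul_pow]; ring
    _ = _ := by rw [← h3, ← h4, ← mul_pow, ← mul_pow, ← mul_pow, ← mul_pow]

lemma one_le_log_natCast {p : ℕ} (hp : 3 ≤ p) : 1 ≤ Real.log p := by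
  rw [Real.le_log_iff_exp_le (by positivity)]
  have h1 := Real.exp_one_lt_d9
  have h2 : (3 : ℝ) ≤ p := by exact_mod_cast hp
  linarith

lemma mul_norm_twistedSum_le {p : ℕ} [Fact p.Prime] (ψ : AddChar (ZMod p) ℂ) (N : ℤ)
    {A B M : ℕ} {E : ℝ} (hE : ∀ h ≤ A * B, ∀ N, ‖twistedSum p ψ N h‖ ≤ E) :
    A * B * ‖twistedSum p ψ N M‖ ≤
      ‖∑ a ∈ Finset.Icc 1 A, ∑ b : Fin B, twistedSum p ψ (N + (a * b : ℕ)) M‖ +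
        A * B * (2 * E) := by
  have h1 : ((A * B : ℕ) : ℂ) * twistedSum p ψ N M =
      (∑ a ∈ Finset.Icc 1 A, ∑ b : Fin B, twistedSum p ψ (N + (a * b : ℕ)) M) +
      ∑ a ∈ Finset.Icc 1 A, ∑ b : Fin B,
        (twistedSum p ψ N M - twistedSum p ψ (N + (a * b : ℕ)) M) := by
    simp [mul_assoc]
  have h2 : ‖∑ a ∈ Finset.Icc 1 A, ∑ b : Fin B,
      (twistedSum p ψ N M - twistedSum p ψ (N + (a * b : ℕ)) M)‖ ≤ A * B * (2 * E) := by
    calc _ ≤ ∑ a ∈ Finset.Icc 1 A, ∑ b : Fin B, 2 * E := by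
          refine (norm_sum_le _ _).trans (Finset.sum_le_sum fun a ha => ?_)
          refine (norm_sum_le _ _).trans (Finset.sum_le_sum fun b _ => ?_)
          rw [Finset.mem_Icc] at ha
          exact norm_twistedSum_sub_shift_le ψ N M _ (hE _ (Nat.mul_le_mul ha.2 b.2.le))
      _ = _ := by simp; ring
  calc _ = ‖((A * B : ℕ) : ℂ) * twistedSum p ψ N M‖ := by simp
    _ ≤ _ := by
        rw [h1]
        exact (norm_add_le _ _).trans (by gcongr)

lemma norm_twistedSum_le_of_short {p : ℕ} [Fact p.Prime] (hp : p ≠ 2)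
    (ψ : AddChar (ZMod p) ℂ) (N : ℤ) {ν M : ℕ} (hν : 2 ≤ ν) {γ μ E : ℝ} (hγ : 1 ≤ γ)
    (hγp : (γ ^ 2) ^ (ν - 1) = √p) (hμ : 0 ≤ μ) (hμM : μ ^ ν = (M : ℝ) ^ (ν - 1))
    (hM : 1024 * γ ^ 2 ≤ M) (hMp : (M : ℝ) ^ 2 ≤ 8 * p * γ ^ 2)
    (hE : ∀ h ≤ M / 16, ∀ N, ‖twistedSum p ψ N h‖ ≤ E) :
    ‖twistedSum p ψ N M‖ ≤ burgessMainConst ν * γ * μ * Real.log p + 2 * E := by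
  have hpp : p.Prime := Fact.out
  have hp3 : 3 ≤ p := by have := hpp.two_le; omega
  have hl := one_le_log_natCast hp3
  have hβ1 : (1 : ℝ) ≤ γ ^ 2 := one_le_pow₀ hγ
  obtain ⟨β, hβ⟩ : ∃ β, β = γ ^ 2 := ⟨_, rfl⟩
  rw [← hβ] at hβ1 hM hMp hγp
  have hpR : (1 : ℝ) ≤ p := by exact_mod_cast hpp.one_le
  have hsq : √(p : ℝ) ^ 2 = p := Real.sq_sqrt (by positivity)
  have hβp : β ≤ p := by
    calc β ≤ β ^ (ν - 1) := le_self_pow₀ hβ1 (by omega)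
      _ = √p := hγp
      _ ≤ p := by rw [Real.sqrt_le_left (by positivity)]; nlinarith
  obtain ⟨B, hB⟩ : ∃ B, B = ⌈β⌉₊ := ⟨_, rfl⟩
  have hβB : β ≤ B := hB ▸ Nat.le_ceil β
  have hBβ : (B : ℝ) ≤ 2 * β := by
    have := Nat.ceil_lt_add_one (show 0 ≤ β by linarith)
    rw [← hB] at this
    linarith
  have hBp : B ≤ p := by rw [hB]; exact Nat.ceil_le.2 hβp
  have hB1 : 1 ≤ B := by
    have : (1 : ℝ) ≤ B := hβ1.trans hβB
    exact_mod_cast this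
  have hMB : 512 * B ≤ M := by
    have : (512 : ℝ) * B ≤ M := by linarith
    exact_mod_cast this
  obtain ⟨A, hA⟩ : ∃ A, A = M / (16 * B) := ⟨_, rfl⟩
  have hA1 : 1 ≤ A := by
    rw [hA, Nat.one_le_div_iff (by omega)]
    omega
  have hAB : A * B ≤ M / 16 := by
    rw [Nat.le_div_iff_mul_le (by omega), hA]
    calc M / (16 * B) * B * 16 = M / (16 * B) * (16 * B) := by ring
      _ ≤ M := Nat.div_mul_le_self _ _
  have hABM : 16 * (A * B) ≤ M := by omega
  have hAM : A ≤ M := by nlinarith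
  have hMA : (M : ℝ) ≤ 32 * (A * B) := by
    have h1 : M < 16 * B * (A + 1) := by
      rw [hA]
      have := Nat.lt_mul_div_succ M (show 0 < 16 * B by omega)
      simpa using this
    have h2 : M ≤ 32 * (A * B) := by nlinarith
    exact_mod_cast h2
  have hAMp : 2 * A * M ≤ p := by
    have h1 : (16 : ℝ) * (A * B) ≤ M := by exact_mod_cast hABM
    have h2 : (2 * A * M : ℝ) * (8 * β) ≤ p * (8 * β) := by
      calc (2 * A * M : ℝ) * (8 * β) ≤ (2 * A * M : ℝ) * (8 * B) := by gcongr
        _ = (16 * (A * B)) * M := by ring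
        _ ≤ M * M := by gcongr
        _ ≤ _ := by linarith
    have h3 := le_of_mul_le_mul_right h2 (by linarith)
    exact_mod_cast h3
  have hAR : (1 : ℝ) ≤ A := by exact_mod_cast hA1
  have hlogA : Real.log A ≤ Real.log p := by
    refine Real.log_le_log (by linarith) ?_
    have : A ≤ p := by nlinarith
    exact_mod_cast this
  have hpow := norm_sum_shifts_pow_le hp ψ N (ν := ν) (by omega) hA1 hAM hAMp hB1 hBp
  have hmain := le_of_pow_le_moment (ν := ν) (l := Real.log p) (s := √p) (γ := γ) (μ := μ)
    (L := 1 + Real.log A) (by omega) (by linarith) (by positivity) (by linarith)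
    (Real.sqrt_nonneg _) (by linarith) hμ hl (by have := Real.log_nonneg hAR; linarith)
    (by linarith) hβ hγp hμM hβB hBβ hMA (by rw [hsq]; exact hpow)
  have hav := mul_norm_twistedSum_le ψ N (M := M) (fun h hh N => hE h (hh.trans hAB) N)
  have hABpos : (0 : ℝ) < A * B := by positivity
  refine le_of_mul_le_mul_left ?_ hABpos
  calc _ ≤ _ := hav
    _ ≤ _ := by rw [mul_add]; gcongr

lemma norm_twistedSum_le_of_sq_le {p : ℕ} [Fact p.Prime] (hp : p ≠ 2)
    (ψ : AddChar (ZMod p) ℂ) {ν : ℕ} (hν : 2 ≤ ν) {γ : ℝ} (hγ : 1 ≤ γ)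
    (hγp : (γ ^ 2) ^ (ν - 1) = √p) (M : ℕ) :
    ∀ N : ℤ, (M : ℝ) ^ 2 ≤ 8 * p * γ ^ 2 →
      ‖twistedSum p ψ N M‖ ≤
        2 * burgessMainConst ν * (M : ℝ) ^ (1 - 1 / (ν : ℝ)) * γ * Real.log p ^ 2 := by
  have hpp : p.Prime := Fact.out
  have hp3 : 3 ≤ p := by have := hpp.two_le; omega
  have hl := one_le_log_natCast hp3
  have hc := le_burgessMainConst (show 1 ≤ ν by omega)
  have hνR : (2 : ℝ) ≤ ν := by exact_mod_cast hν
  have hν2 : 1 / (ν : ℝ) ≤ 1 / 2 := one_div_le_one_div_of_le (by norm_num) hνR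
  induction M using Nat.strong_induction_on with
  | _ M ih =>
  intro N hMp
  rcases Nat.eq_zero_or_pos M with rfl | hM0
  · simp only [twistedSum, Finset.range_zero, Finset.sum_empty, norm_zero]
    positivity
  have hMR : (1 : ℝ) ≤ M := by exact_mod_cast hM0
  have hM0R : (0 : ℝ) < M := by linarith
  obtain ⟨μ, hμ⟩ : ∃ μ, μ = (M : ℝ) ^ (1 - 1 / (ν : ℝ)) := ⟨_, rfl⟩
  obtain ⟨r, hr⟩ : ∃ r, r = (M : ℝ) ^ (1 / (ν : ℝ)) := ⟨_, rfl⟩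
  have hμ0 : 0 ≤ μ := hμ ▸ by positivity
  have hr0 : 0 ≤ r := hr ▸ by positivity
  have hμr : μ * r = M := by
    rw [hμ, hr, ← Real.rpow_add hM0R]
    simp
  rw [← hμ]
  have hl2 : Real.log p ≤ Real.log p ^ 2 := by nlinarith
  by_cases hrγ : r ≤ 32 * γ
  · calc ‖twistedSum p ψ N M‖ ≤ M := norm_twistedSum_le ψ N M
      _ = μ * r * 1 := by rw [hμr, mul_one]
      _ ≤ μ * (32 * γ) * Real.log p ^ 2 := by gcongr; linarith
      _ = 32 * μ * γ * Real.log p ^ 2 := by ring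
      _ ≤ _ := by gcongr; linarith
  · push Not at hrγ
    have hrμ : r ≤ μ := by
      rw [hr, hμ]
      exact Real.rpow_le_rpow_of_exponent_le hMR (by linarith)
    have hMγ : 1024 * γ ^ 2 ≤ M := by nlinarith
    have hμM : μ ^ ν = (M : ℝ) ^ (ν - 1) := by
      rw [hμ, ← Real.rpow_natCast, ← Real.rpow_mul hM0R.le, ← Real.rpow_natCast,
        Nat.cast_sub (by omega)]
      congr 1
      field_simp
      simp
    have h16 : ((M : ℝ) / 16) ^ (1 - 1 / (ν : ℝ)) ≤ μ / 4 := by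
      rw [Real.div_rpow hM0R.le (by norm_num), ← hμ]
      gcongr
      calc (4 : ℝ) = 16 ^ (1 / 2 : ℝ) := by
            rw [← Real.sqrt_eq_rpow, show (16 : ℝ) = 4 ^ 2 by norm_num]
            exact (Real.sqrt_sq (by norm_num)).symm
        _ ≤ _ := Real.rpow_le_rpow_of_exponent_le (by norm_num) (by linarith)
    have hE : ∀ h ≤ M / 16, ∀ N, ‖twistedSum p ψ N h‖ ≤
        2 * burgessMainConst ν * (μ / 4) * γ * Real.log p ^ 2 := by
      intro h hh N
      have hhM : (h : ℝ) ≤ M / 16 := by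
        have h1 : 16 * h ≤ M := by omega
        have h2 : (16 : ℝ) * h ≤ M := by exact_mod_cast h1
        linarith
      have hh0 : (0 : ℝ) ≤ h := by positivity
      refine (ih h (by omega) N (by nlinarith)).trans ?_
      gcongr
      refine (Real.rpow_le_rpow hh0 hhM (by linarith)).trans h16
    refine (norm_twistedSum_le_of_short hp ψ N hν hγ hγp hμ0 hμM hMγ hMp hE).trans ?_
    have h1 : burgessMainConst ν * γ * μ * Real.log p ≤
        burgessMainConst ν * γ * μ * Real.log p ^ 2 := by gcongr
    linarith

end Induction

section Geometric

lemma sum_zmod_eq_sum_range {p : ℕ} [NeZero p] {R : Type*} [AddCommMonoid R] (g : ZMod p → R) :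
    ∑ y, g y = ∑ k ∈ Finset.range p, g (k : ZMod p) := by
  refine Finset.sum_bij' (fun y _ => y.val) (fun k _ => (k : ZMod p)) ?_ ?_ ?_ ?_ ?_
  · intro y _
    exact Finset.mem_range.2 (ZMod.val_lt y)
  · intro k _
    exact Finset.mem_univ _
  · intro y _
    exact ZMod.natCast_zmod_val y
  · intro k hk
    exact ZMod.val_cast_of_lt (Finset.mem_range.1 hk)
  · intro y _
    rw [ZMod.natCast_zmod_val]

lemma sum_Icc_eq_sum_range_add {R : Type*} [AddCommMonoid R] (f : ℕ → R) (K M : ℕ) :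
    ∑ m ∈ Finset.Icc (K + 1) (K + M), f m = ∑ l ∈ Finset.range M, f (K + 1 + l) := by
  rw [← Finset.Ico_add_one_right_eq_Icc, Finset.sum_Ico_eq_sum_range]
  congr 2
  omega

lemma two_mul_mul_one_sub_le_sin {x : ℝ} (h0 : 0 ≤ x) (h1 : x ≤ 1) :
    2 * (x * (1 - x)) ≤ Real.sin (Real.pi * x) := by
  wlog h : x ≤ 1 / 2 generalizing x
  · have := this (x := 1 - x) (by linarith) (by linarith) (by linarith)
    rw [show Real.pi * (1 - x) = Real.pi - Real.pi * x by ring, Real.sin_pi_sub] at this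
    linarith
  · have hpi := Real.pi_pos
    have := Real.mul_le_sin (x := Real.pi * x) (by positivity) (by nlinarith)
    rw [show 2 / Real.pi * (Real.pi * x) = 2 * x by field_simp] at this
    nlinarith

lemma le_norm_stdAddChar_sub_one {p : ℕ} [NeZero p] {k : ℕ} (hk : k ≤ p) :
    4 * ((k : ℝ) / p * (1 - k / p)) ≤ ‖ZMod.stdAddChar (k : ZMod p) - 1‖ := by
  have hp : (0 : ℝ) < p := by exact_mod_cast Nat.pos_of_ne_zero (NeZero.ne p)
  have h1 : ZMod.stdAddChar (k : ZMod p) =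
      Complex.exp (Complex.I * ((2 * (Real.pi * (k / p)) : ℝ) : ℂ)) := by
    have := ZMod.stdAddChar_coe (N := p) (k : ℤ)
    rw [Int.cast_natCast] at this
    rw [this]
    push_cast
    ring_nf
  rw [h1, Complex.norm_exp_I_mul_ofReal_sub_one, Real.norm_eq_abs]
  refine le_trans ?_ (le_abs_self _)
  have := two_mul_mul_one_sub_le_sin (x := (k : ℝ) / p) (by positivity)
    ((div_le_one hp).2 (by exact_mod_cast hk))
  rw [mul_div_cancel_left₀ _ (two_ne_zero)]
  linarith

lemma norm_sum_pow_mul_le {z : ℂ} (hz : ‖z‖ = 1) (K M : ℕ) :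
    ‖∑ m ∈ Finset.Icc (K + 1) (K + M), z ^ m‖ * ‖z - 1‖ ≤ 2 := by
  rw [sum_Icc_eq_sum_range_add]
  simp only [pow_add _ (K + 1)]
  rw [← Finset.mul_sum, ← norm_mul, mul_assoc, geom_sum_mul, norm_mul, norm_pow, hz, one_pow,
    one_mul]
  calc ‖z ^ M - 1‖ ≤ ‖z ^ M‖ + ‖(1 : ℂ)‖ := norm_sub_le _ _
    _ = 2 := by rw [norm_pow, hz]; norm_num

lemma norm_sum_stdAddChar_le {p : ℕ} [NeZero p] {k : ℕ} (hk : 0 < k) (hkp : k < p) (K M : ℕ) :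
    ‖∑ m ∈ Finset.Icc (K + 1) (K + M), ZMod.stdAddChar ((m : ZMod p) * (k : ZMod p))‖ ≤
      p / 2 * (1 / (k : ℝ) + 1 / ((p - k : ℕ) : ℝ)) := by
  have hk0 : (0 : ℝ) < k := by exact_mod_cast hk
  have hkp' : (k : ℝ) < p := by exact_mod_cast hkp
  have h1 := norm_sum_pow_mul_le (z := ZMod.stdAddChar (k : ZMod p)) (AddChar.norm_apply _ _) K M
  have h2 := le_norm_stdAddChar_sub_one (p := p) hkp.le
  simp only [← nsmul_eq_mul, AddChar.map_nsmul_eq_pow]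
  rw [Nat.cast_sub hkp.le]
  have h3 : 0 < 4 * ((k : ℝ) / p * (1 - k / p)) := by
    have : (k : ℝ) / p < 1 := (div_lt_one (by linarith)).2 hkp'
    have : 0 < 1 - (k : ℝ) / p := by linarith
    have : (0 : ℝ) < p := by linarith
    positivity
  calc _ ≤ 2 / (4 * ((k : ℝ) / p * (1 - k / p))) := by
        rw [le_div_iff₀ h3]
        exact (mul_le_mul_of_nonneg_left h2 (norm_nonneg _)).trans h1
    _ = _ := by
        have : (p : ℝ) - k ≠ 0 := by linarith
        have : (p : ℝ) ≠ 0 := by linarith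
        field_simp
        ring

lemma sum_norm_sum_stdAddChar_le {p : ℕ} [NeZero p] (K M : ℕ) :
    ∑ y : ZMod p, ‖∑ m ∈ Finset.Icc (K + 1) (K + M), ZMod.stdAddChar ((m : ZMod p) * y)‖ ≤
      M + p * (1 + Real.log p) := by
  obtain ⟨n, rfl⟩ : ∃ n, p = n + 1 := ⟨p - 1, by have := NeZero.ne p; omega⟩
  rw [sum_zmod_eq_sum_range, Finset.sum_range_succ', add_comm]
  refine add_le_add (by simp) ?_
  have hH : ∑ i ∈ Finset.range n, 1 / ((i : ℝ) + 1) ≤ 1 + Real.log (n + 1 : ℕ) := by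
    have h1 := harmonic_le_one_add_log n
    simp only [harmonic] at h1
    push_cast at h1
    simp only [one_div]
    refine h1.trans ?_
    rcases Nat.eq_zero_or_pos n with rfl | hn
    · simp
    · gcongr
      linarith
  have hH' : ∑ i ∈ Finset.range n, 1 / ((n - i : ℕ) : ℝ) =
      ∑ i ∈ Finset.range n, 1 / ((i : ℝ) + 1) := by
    rw [← Finset.sum_range_reflect]
    refine Finset.sum_congr rfl fun i hi => ?_
    rw [Finset.mem_range] at hi
    rw [show n - (n - 1 - i) = i + 1 by omega]
    push_cast
    rfl
  calc _ ≤ ∑ i ∈ Finset.range n, ((n + 1 : ℕ) : ℝ) / 2 *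
        (1 / ((i : ℝ) + 1) + 1 / ((n - i : ℕ) : ℝ)) := by
        refine Finset.sum_le_sum fun i hi => ?_
        rw [Finset.mem_range] at hi
        refine (norm_sum_stdAddChar_le (Nat.succ_pos i) (by omega) K M).trans (le_of_eq ?_)
        rw [show n + 1 - (i + 1) = n - i by omega]
        push_cast
        rfl
    _ = ((n + 1 : ℕ) : ℝ) * ∑ i ∈ Finset.range n, 1 / ((i : ℝ) + 1) := by
        rw [← Finset.mul_sum, Finset.sum_add_distrib, hH']
        ring
    _ ≤ _ := by gcongr

end Geometric

section Quadratic

/-- A quadratic polynomial takes each value at most twice. -/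
lemma card_quadratic_fiber_le {F : Type*} [Field F] [Fintype F] [DecidableEq F] {a : F}
    (ha : a ≠ 0) (b y : F) :
    (Finset.univ.filter fun x => a * x ^ 2 + b * x = y).card ≤ 2 := by
  by_cases h : ∃ x₀, a * x₀ ^ 2 + b * x₀ = y
  · obtain ⟨x₀, hx₀⟩ := h
    refine (Finset.card_le_card (t := {x₀, -b / a - x₀}) fun x hx => ?_).trans Finset.card_le_two
    simp only [Finset.mem_filter, Finset.mem_univ, true_and] at hx
    have h1 : (x - x₀) * (a * (x + x₀) + b) = 0 := by linear_combination hx - hx₀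
    rcases mul_eq_zero.1 h1 with h2 | h2
    · simp [sub_eq_zero.1 h2]
    · have : x = -b / a - x₀ := by
        field_simp
        linear_combination h2
      simp [this]
  · rw [Finset.filter_eq_empty_iff.2 fun x _ hx => h ⟨x, hx⟩]
    simp

lemma sum_comp_quadratic_le {F : Type*} [Field F] [Fintype F] {a : F} (ha : a ≠ 0) (b : F)
    {g : F → ℝ} (hg : ∀ y, 0 ≤ g y) :
    ∑ x, g (a * x ^ 2 + b * x) ≤ 2 * ∑ y, g y := by
  classical
  rw [← Finset.sum_fiberwise' Finset.univ (fun x => a * x ^ 2 + b * x) g, Finset.mul_sum]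
  refine Finset.sum_le_sum fun y _ => ?_
  rw [Finset.sum_const, nsmul_eq_mul]
  have := card_quadratic_fiber_le ha b y
  gcongr
  · exact hg y
  · exact_mod_cast this

lemma norm_sum_sum_quadratic_le {p : ℕ} [Fact p.Prime] {a : ZMod p} (ha : a ≠ 0) (b : ZMod p)
    (K M : ℕ) :
    ‖∑ m ∈ Finset.Icc (K + 1) (K + M), ∑ x : ZMod p,
      ZMod.stdAddChar ((m : ZMod p) * (a * x ^ 2 + b * x))‖ ≤
      2 * (M + p * (1 + Real.log p)) := by
  rw [Finset.sum_comm]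
  refine (norm_sum_le _ _).trans ?_
  refine (sum_comp_quadratic_le ha b (g := fun y => ‖∑ m ∈ Finset.Icc (K + 1) (K + M),
    ZMod.stdAddChar ((m : ZMod p) * y)‖) fun y => norm_nonneg _).trans ?_
  gcongr
  exact sum_norm_sum_stdAddChar_le K M

lemma quadraticChar_complex_ne_one {p : ℕ} [Fact p.Prime] (hp : p ≠ 2) :
    (quadraticChar (ZMod p)).ringHomComp (Int.castRingHom ℂ) ≠ 1 :=
  (MulChar.ringHomComp_ne_one_iff (RingHom.injective_int _)).2
    (quadraticChar_ne_one (by rwa [ZMod.ringChar_zmod_n]))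

/-- The quadratic Gauss sum modulo `p`. -/
noncomputable def quadraticGaussSum (p : ℕ) [Fact p.Prime] : ℂ :=
  gaussSum ((quadraticChar (ZMod p)).ringHomComp (Int.castRingHom ℂ)) ZMod.stdAddChar

lemma norm_quadraticGaussSum {p : ℕ} [Fact p.Prime] (hp : p ≠ 2) :
    ‖quadraticGaussSum p‖ = √p := by
  have h := gaussSum_sq (quadraticChar_complex_ne_one hp)
    ((quadraticChar_isQuadratic (ZMod p)).comp _) (ZMod.isPrimitive_stdAddChar p)
  have h2 : ‖quadraticGaussSum p‖ ^ 2 = p := by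
    rw [← norm_pow, quadraticGaussSum, h, norm_mul, ZMod.card, Complex.norm_natCast]
    rcases quadraticChar_dichotomy (neg_ne_zero.2 (one_ne_zero (α := ZMod p))) with h1 | h1 <;>
      simp [h1]
  rw [← h2, Real.sqrt_sq (norm_nonneg _)]

lemma sum_stdAddChar_mul_sq {p : ℕ} [Fact p.Prime] (hp : p ≠ 2) {t : ZMod p} (ht : t ≠ 0) :
    ∑ x : ZMod p, ZMod.stdAddChar (t * x ^ 2) =
      (quadraticChar (ZMod p) t : ℂ) * quadraticGaussSum p := by
  have hrc : ringChar (ZMod p) ≠ 2 := by rwa [ZMod.ringChar_zmod_n]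
  have h1 : ∑ x : ZMod p, ZMod.stdAddChar (t * x ^ 2) =
      ∑ y : ZMod p, ((quadraticChar (ZMod p) y : ℂ) + 1) * ZMod.stdAddChar (t * y) := by
    rw [← Finset.sum_fiberwise' Finset.univ (fun x : ZMod p => x ^ 2)
      (fun y => ZMod.stdAddChar (t * y))]
    refine Finset.sum_congr rfl fun y _ => ?_
    rw [Finset.sum_const, nsmul_eq_mul]
    congr 1
    have h := quadraticChar_card_sqrts hrc y
    rw [Set.toFinset_ofPred] at h
    exact_mod_cast congrArg (fun n : ℤ => (n : ℂ)) h
  have h2 : ∑ y : ZMod p, ZMod.stdAddChar (t * y) = 0 := by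
    have := AddChar.sum_mulShift t (ZMod.isPrimitive_stdAddChar p)
    simpa [mul_comm, ht] using this
  have h3 := gaussSum_mulShift ((quadraticChar (ZMod p)).ringHomComp (Int.castRingHom ℂ))
    ZMod.stdAddChar (Units.mk0 t ht)
  have h4 : (quadraticChar (ZMod p) t : ℂ) * quadraticChar (ZMod p) t = 1 := by
    rcases quadraticChar_dichotomy ht with h | h <;> simp [h]
  rw [h1]
  simp only [add_mul, one_mul, Finset.sum_add_distrib, h2, add_zero]
  rw [quadraticGaussSum, ← h3]
  simp only [gaussSum, AddChar.mulShift_apply, MulChar.ringHomComp_apply, Units.val_mk0,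
    eq_intCast]
  rw [← mul_assoc, h4, one_mul]

lemma sum_stdAddChar_quadratic {p : ℕ} [Fact p.Prime] (hp : p ≠ 2) {a m : ZMod p} (ha : a ≠ 0)
    (hm : m ≠ 0) (b : ZMod p) :
    ∑ x : ZMod p, ZMod.stdAddChar (m * (a * x ^ 2 + b * x)) =
      (quadraticChar (ZMod p) a : ℂ) * quadraticGaussSum p *
      ((quadraticChar (ZMod p) m : ℂ) * ZMod.stdAddChar.mulShift (-(b ^ 2 / (4 * a))) m) := by
  have h2 : (2 : ZMod p) ≠ 0 := by
    have := Ring.two_ne_zero (R := ZMod p) (by rwa [ZMod.ringChar_zmod_n])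
    exact this
  have h4 : (4 : ZMod p) ≠ 0 := by
    rw [show (4 : ZMod p) = 2 * 2 by norm_num]
    exact mul_ne_zero h2 h2
  have h1 : ∀ x : ZMod p, ZMod.stdAddChar (m * (a * x ^ 2 + b * x)) =
      ZMod.stdAddChar (m * a * (x + b / (2 * a)) ^ 2) *
        ZMod.stdAddChar.mulShift (-(b ^ 2 / (4 * a))) m := by
    intro x
    rw [AddChar.mulShift_apply, ← AddChar.map_add_eq_mul]
    congr 1
    field_simp
    ring
  simp only [h1]
  have h3 := Equiv.sum_comp (Equiv.addRight (b / (2 * a)))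
    (fun x => (ZMod.stdAddChar (m * a * x ^ 2) : ℂ))
  simp only [Equiv.coe_addRight] at h3
  rw [← Finset.sum_mul, h3, sum_stdAddChar_mul_sq hp (mul_ne_zero hm ha), map_mul]
  push_cast
  ring

lemma norm_sum_sum_quadratic_eq {p : ℕ} [Fact p.Prime] (hp : p ≠ 2) {a : ZMod p} (ha : a ≠ 0)
    (b : ZMod p) {K M : ℕ} (hKM : K + M < p) :
    ‖∑ m ∈ Finset.Icc (K + 1) (K + M), ∑ x : ZMod p,
      ZMod.stdAddChar ((m : ZMod p) * (a * x ^ 2 + b * x))‖ =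
      √p * ‖twistedSum p (ZMod.stdAddChar.mulShift (-(b ^ 2 / (4 * a)))) (K + 1) M‖ := by
  have h1 : ∑ m ∈ Finset.Icc (K + 1) (K + M), ∑ x : ZMod p,
      ZMod.stdAddChar ((m : ZMod p) * (a * x ^ 2 + b * x)) =
      (quadraticChar (ZMod p) a : ℂ) * quadraticGaussSum p *
        twistedSum p (ZMod.stdAddChar.mulShift (-(b ^ 2 / (4 * a)))) (K + 1) M := by
    rw [sum_Icc_eq_sum_range_add, twistedSum, Finset.mul_sum]
    refine Finset.sum_congr rfl fun l hl => ?_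
    rw [Finset.mem_range] at hl
    have hm : ((K + 1 + l : ℕ) : ZMod p) ≠ 0 := by
      rw [Ne, ZMod.natCast_eq_zero_iff]
      intro h
      have := Nat.le_of_dvd (by omega) h
      omega
    rw [sum_stdAddChar_quadratic hp ha hm]
    push_cast
    rfl
  rw [h1, norm_mul, norm_mul, norm_quadraticGaussSum hp]
  rcases quadraticChar_dichotomy ha with h | h <;> simp [h]

end Quadratic

section Final

lemma ep_eq_stdAddChar (p : ℕ) [NeZero p] (z : ℤ) : ep p z = ZMod.stdAddChar (z : ZMod p) :=
  (ZMod.stdAddChar_coe z).symm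

lemma sum_sum_ep_eq {p : ℕ} [NeZero p] (a b : ℤ) (K M : ℕ) :
    ∑ m ∈ Finset.Icc (K + 1) (K + M),
      ∑ x ∈ Finset.range p, ep p (m * (a * (x : ℤ) ^ 2 + b * x)) =
    ∑ m ∈ Finset.Icc (K + 1) (K + M), ∑ x : ZMod p,
      ZMod.stdAddChar ((m : ZMod p) * ((a : ZMod p) * x ^ 2 + (b : ZMod p) * x)) := by
  refine Finset.sum_congr rfl fun m _ => ?_
  rw [sum_zmod_eq_sum_range]
  refine Finset.sum_congr rfl fun x _ => ?_
  rw [ep_eq_stdAddChar]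
  push_cast
  rfl

lemma norm_sum_sum_ep_two_le (a b : ℤ) {K M : ℕ} (hKM : K + M ≤ 1) :
    ‖∑ m ∈ Finset.Icc (K + 1) (K + M),
      ∑ x ∈ Finset.range 2, ep 2 (m * (a * (x : ℤ) ^ 2 + b * x))‖ ≤ 2 := by
  calc _ ≤ ∑ m ∈ Finset.Icc (K + 1) (K + M), ∑ x ∈ Finset.range 2, (1 : ℝ) := by
        refine (norm_sum_le _ _).trans (Finset.sum_le_sum fun m _ => ?_)
        refine (norm_sum_le _ _).trans (Finset.sum_le_sum fun x _ => ?_)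
        rw [ep_eq_stdAddChar, AddChar.norm_apply]
    _ ≤ 2 := by
        have : (M : ℝ) ≤ 1 := by exact_mod_cast (by omega : M ≤ 1)
        simp
        linarith

/-- For `M ≥ √p * p ^ (1 / (4 * (ν - 1)))` the bound of Burgess type is trivially at least `p`. -/
lemma le_rpow_mul_rpow {p M ν : ℝ} (hp : 1 ≤ p) (hν : 2 ≤ ν)
    (h : p ^ ((2 * ν - 1) / (4 * (ν - 1))) ≤ M) :
    p ≤ M ^ (1 - 1 / ν) * p ^ ((2 * ν - 1) / (4 * (ν - 1))) := by
  have hp0 : 0 ≤ p := by linarith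
  have h0 : 0 ≤ 1 - 1 / ν := by
    rw [sub_nonneg, div_le_one (by linarith)]
    linarith
  have hν1 : 0 < ν - 1 := by linarith
  have h1 : (1 : ℝ) ≤ (2 * ν - 1) / (4 * (ν - 1)) * (1 - 1 / ν) +
      (2 * ν - 1) / (4 * (ν - 1)) := by
    have : (2 * ν - 1) / (4 * (ν - 1)) * (1 - 1 / ν) + (2 * ν - 1) / (4 * (ν - 1)) - 1 =
        1 / (4 * (ν * (ν - 1))) := by
      field_simp
      ring
    have h2 : 0 < 1 / (4 * (ν * (ν - 1))) := by positivity
    linarith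
  calc p = p ^ (1 : ℝ) := (Real.rpow_one p).symm
    _ ≤ p ^ ((2 * ν - 1) / (4 * (ν - 1)) * (1 - 1 / ν) + (2 * ν - 1) / (4 * (ν - 1))) :=
        Real.rpow_le_rpow_of_exponent_le hp h1
    _ = (p ^ ((2 * ν - 1) / (4 * (ν - 1)))) ^ (1 - 1 / ν) * p ^ ((2 * ν - 1) / (4 * (ν - 1))) := by
        rw [Real.rpow_add (by linarith), Real.rpow_mul hp0]
    _ ≤ _ := by gcongr

lemma norm_sum_sum_quadratic_le_odd {p : ℕ} [Fact p.Prime] (hp : p ≠ 2) {a : ZMod p} (ha : a ≠ 0)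
    (b : ZMod p) {ν : ℕ} (hν : 2 ≤ ν) {K M : ℕ} (hKM : K + M < p) :
    ‖∑ m ∈ Finset.Icc (K + 1) (K + M), ∑ x : ZMod p,
      ZMod.stdAddChar ((m : ZMod p) * (a * x ^ 2 + b * x))‖ ≤
      2 * burgessMainConst ν * (M : ℝ) ^ (1 - 1 / (ν : ℝ)) *
        (p : ℝ) ^ ((2 * (ν : ℝ) - 1) / (4 * ((ν : ℝ) - 1))) * Real.log p ^ 2 := by
  have hpp : p.Prime := Fact.out
  have hp3 : 3 ≤ p := by have := hpp.two_le; omega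
  have hl := one_le_log_natCast hp3
  have hl2 : Real.log p ≤ Real.log p ^ 2 := by nlinarith
  have hc := le_burgessMainConst (show 1 ≤ ν by omega)
  have hνR : (2 : ℝ) ≤ ν := by exact_mod_cast hν
  have hν1 : 0 < (ν : ℝ) - 1 := by linarith
  have hpR : (1 : ℝ) ≤ p := by exact_mod_cast hpp.one_le
  have hp0 : (0 : ℝ) < p := by linarith
  obtain ⟨γ, hγ⟩ : ∃ γ, γ = (p : ℝ) ^ (1 / (4 * ((ν : ℝ) - 1))) := ⟨_, rfl⟩
  have hγ1 : 1 ≤ γ := hγ ▸ Real.one_le_rpow hpR (by positivity)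
  have hγp : (γ ^ 2) ^ (ν - 1) = √p := by
    rw [← pow_mul, hγ, ← Real.rpow_natCast, ← Real.rpow_mul hp0.le, Real.sqrt_eq_rpow]
    push_cast [Nat.cast_sub (show 1 ≤ ν by omega)]
    congr 1
    field_simp
    norm_num
  have hexp : (p : ℝ) ^ ((2 * (ν : ℝ) - 1) / (4 * ((ν : ℝ) - 1))) = √p * γ := by
    rw [hγ, Real.sqrt_eq_rpow, ← Real.rpow_add hp0]
    congr 1
    field_simp
    ring
  by_cases hM : (M : ℝ) ^ 2 ≤ 8 * p * γ ^ 2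
  · rw [norm_sum_sum_quadratic_eq hp ha b hKM, hexp]
    have := norm_twistedSum_le_of_sq_le hp (ZMod.stdAddChar.mulShift (-(b ^ 2 / (4 * a)))) hν hγ1
      hγp M (K + 1) hM
    calc _ ≤ √p * _ := mul_le_mul_of_nonneg_left this (Real.sqrt_nonneg _)
      _ = _ := by ring
  · push Not at hM
    have h1 : √p * γ ≤ M := by
      refine le_of_sq_le_sq ?_ (by positivity)
      rw [mul_pow, Real.sq_sqrt hp0.le]
      have : 0 ≤ p * γ ^ 2 := by positivity
      linarith
    have h2 := le_rpow_mul_rpow (M := M) hpR hνR (hexp ▸ h1)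
    have hMp : (M : ℝ) ≤ p := by exact_mod_cast (by omega : M ≤ p)
    calc _ ≤ 2 * (M + p * (1 + Real.log p)) := norm_sum_sum_quadratic_le ha b K M
      _ ≤ 6 * (p * Real.log p ^ 2) := by nlinarith
      _ ≤ 6 * (((M : ℝ) ^ (1 - 1 / (ν : ℝ)) *
          (p : ℝ) ^ ((2 * (ν : ℝ) - 1) / (4 * ((ν : ℝ) - 1)))) * Real.log p ^ 2) := by gcongr
      _ = 6 * (M : ℝ) ^ (1 - 1 / (ν : ℝ)) *
          (p : ℝ) ^ ((2 * (ν : ℝ) - 1) / (4 * ((ν : ℝ) - 1))) * Real.log p ^ 2 := by ring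
      _ ≤ _ := by gcongr; linarith

end Final

theorem quadratic_Burgess_bound :
    ∀ ν : ℕ, 2 ≤ ν → ∃ C : ℝ, 0 < C ∧
      ∀ p : ℕ, p.Prime → ∀ a b : ℤ, Int.gcd a p = 1 →
        ∀ K M : ℕ, 1 ≤ M → K + M ≤ p - 1 →
        ‖∑ m ∈ Finset.Icc (K + 1) (K + M),
            ∑ x ∈ Finset.range p, ep p (m * (a * (x : ℤ) ^ 2 + b * x))‖ ≤
          C * (M : ℝ) ^ (1 - 1 / (ν : ℝ)) *
            (p : ℝ) ^ ((2 * (ν : ℝ) - 1) / (4 * ((ν : ℝ) - 1))) *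
            Real.log p ^ 2 := by
  intro ν hν
  have hc := le_burgessMainConst (show 1 ≤ ν by omega)
  refine ⟨2 * burgessMainConst ν, by linarith, ?_⟩
  intro p hp a b hab K M hM hKM
  have : Fact p.Prime := ⟨hp⟩
  have hp2 := hp.two_le
  by_cases h2 : p = 2
  · subst h2
    refine (norm_sum_sum_ep_two_le a b hKM).trans ?_
    obtain rfl : M = 1 := by omega
    have hνR : (2 : ℝ) ≤ ν := by exact_mod_cast hν
    have h1 : (1 : ℝ) ≤ ((2 : ℕ) : ℝ) ^ ((2 * (ν : ℝ) - 1) / (4 * ((ν : ℝ) - 1))) :=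
      Real.one_le_rpow (by norm_num) (div_nonneg (by linarith) (by linarith))
    have h3 : (1 / 4 : ℝ) ≤ Real.log (2 : ℕ) ^ 2 := by
      have := Real.log_two_gt_d9
      push_cast
      nlinarith
    calc (2 : ℝ) ≤ 2 * 512 * 1 * 1 * (1 / 4) := by norm_num
      _ ≤ _ := by
        rw [Nat.cast_one, Real.one_rpow]
        gcongr
  · rw [sum_sum_ep_eq]
    refine norm_sum_sum_quadratic_le_odd h2 ?_ _ hν (by omega)
    rw [Ne, ZMod.intCast_zmod_eq_zero_iff_dvd]
    intro hdvd
    have h3 : Int.gcd a p = p := by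
      rw [Int.gcd_eq_natAbs_right hdvd]
      simp
    omega
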